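/- (Theorem 7: general convex test functions under convolution) Let f_1,…,f_k be probability densities on R^n and φ : [0,∞) → R convex with φ(0) = 0 and continuous at 0. Then ∫ φ((f_1 ⋆ ⋯ ⋆ f_k)(x)) dx ≤ ∫ φ((f_1* ⋆ ⋯ ⋆ f_k*)(x)) dx, provided both sides are well defined. -/

import Mathlib

open MeasureTheory Set Filter ENNReal

noncomputable section

/-- The spherically symmetric (decreasing) rearrangement of a set `A ⊆ ℝⁿ`:
the centered open ball with the same Lebesgue measure as `A`
(empty if `A` is null, all of `ℝⁿ` if `A` has infinite measure). -/
def ballRearrange (n : ℕ) (A : Set (EuclideanSpace ℝ (Fin n))) :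
    Set (EuclideanSpace ℝ (Fin n)) :=
  {x | volume (Metric.ball (0 : EuclideanSpace ℝ (Fin n)) ‖x‖) < volume A}

/-- The spherically symmetric decreasing rearrangement of a function:
`f*(y) = ∫₀^∞ 1{y ∈ {x : f x > t}*} dt`. -/
def symmRearr (n : ℕ) (f : EuclideanSpace ℝ (Fin n) → ℝ≥0∞) :
    EuclideanSpace ℝ (Fin n) → ℝ≥0∞ :=
  fun y => ∫⁻ t in Ioi (0 : ℝ), (ballRearrange n {x | ENNReal.ofReal t < f x}).indicator 1 y

/-- `f` is a probability density on `ℝⁿ`. -/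
def IsDensity (n : ℕ) (f : EuclideanSpace ℝ (Fin n) → ℝ≥0∞) : Prop :=
  Measurable f ∧ ∫⁻ x, f x = 1

/-- Integral of the positive part of `-f log f`. -/
def entPos (n : ℕ) (f : EuclideanSpace ℝ (Fin n) → ℝ≥0∞) : ℝ≥0∞ :=
  ∫⁻ x, ENNReal.ofReal (-((f x).toReal * Real.log (f x).toReal))

/-- Integral of the negative part of `-f log f`. -/
def entNeg (n : ℕ) (f : EuclideanSpace ℝ (Fin n) → ℝ≥0∞) : ℝ≥0∞ :=
  ∫⁻ x, ENNReal.ofReal ((f x).toReal * Real.log (f x).toReal)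

/-- The Shannon differential entropy `h(f) = -∫ f log f` is well defined. -/
def EntDefined (n : ℕ) (f : EuclideanSpace ℝ (Fin n) → ℝ≥0∞) : Prop :=
  entPos n f ≠ ⊤ ∨ entNeg n f ≠ ⊤

/-- The Shannon differential entropy as an extended real number. -/
def entropy (n : ℕ) (f : EuclideanSpace ℝ (Fin n) → ℝ≥0∞) : EReal :=
  (entPos n f : EReal) - (entNeg n f : EReal)

/-- The Rényi entropy of order `p ∈ (0,1) ∪ (1,∞)`:
`h_p(f) = (1/(1-p)) log ∫ f^p`. -/
def renyi (n : ℕ) (f : EuclideanSpace ℝ (Fin n) → ℝ≥0∞) (p : ℝ) : EReal :=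
  (((1 - p)⁻¹ : ℝ) : EReal) * ENNReal.log (∫⁻ x, f x ^ p)

/-- Convolution of two `ℝ≥0∞`-valued functions on `ℝⁿ`. -/
def conv2 (n : ℕ) (f g : EuclideanSpace ℝ (Fin n) → ℝ≥0∞) :
    EuclideanSpace ℝ (Fin n) → ℝ≥0∞ :=
  fun x => ∫⁻ y, f y * g (x - y)

/-- Iterated convolution of a (nonempty) list of functions. -/
def convList (n : ℕ) : List (EuclideanSpace ℝ (Fin n) → ℝ≥0∞) →
    (EuclideanSpace ℝ (Fin n) → ℝ≥0∞)
  | [] => fun _ => 0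
  | [f] => f
  | f :: g :: rest => conv2 n f (convList n (g :: rest))

/-- `f ≺ g`: `f` is majorized by `g`. -/
def Majorizes (n : ℕ) (f g : EuclideanSpace ℝ (Fin n) → ℝ≥0∞) : Prop :=
  ∀ r : ℝ, 0 < r →
    ∫⁻ x in Metric.ball (0 : EuclideanSpace ℝ (Fin n)) r, symmRearr n f x ≤
      ∫⁻ x in Metric.ball (0 : EuclideanSpace ℝ (Fin n)) r, symmRearr n g x

/-- `∫ φ(f)` is well defined. -/
def PhiDefined (n : ℕ) (φ : ℝ → ℝ) (f : EuclideanSpace ℝ (Fin n) → ℝ≥0∞) : Prop :=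
  (∫⁻ x, ENNReal.ofReal (φ (f x).toReal)) ≠ ⊤ ∨
    (∫⁻ x, ENNReal.ofReal (-(φ (f x).toReal))) ≠ ⊤

/-- The value of `∫ φ(f)` as an extended real number. -/
def phiInt (n : ℕ) (φ : ℝ → ℝ) (f : EuclideanSpace ℝ (Fin n) → ℝ≥0∞) : EReal :=
  ((∫⁻ x, ENNReal.ofReal (φ (f x).toReal)) : EReal) -
    ((∫⁻ x, ENNReal.ofReal (-(φ (f x).toReal))) : EReal)

section RieszSet

lemma measure_fst_snd {G : Type*} [MeasurableSpace G] (μ : Measure G) [SFinite μ] (A B : Set G) :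
    (μ.prod μ) {p | p.1 ∈ A ∧ p.2 ∈ B} = μ A * μ B := by
  rw [← Measure.prod_prod]; rfl

/-- The set of pairs `(x, y)` with `x ∈ A`, `y ∈ B` and `x + y ∈ C`. -/
def rieszSet {G : Type*} [Add G] (A B C : Set G) : Set (G × G) :=
  {p | p.1 ∈ A ∧ p.2 ∈ B ∧ p.1 + p.2 ∈ C}

lemma rieszSet_mono {G : Type*} [Add G] {A B C A' B' C' : Set G}
    (hA : A ⊆ A') (hB : B ⊆ B') (hC : C ⊆ C') :
    rieszSet A B C ⊆ rieszSet A' B' C' :=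
  fun _ hp => ⟨hA hp.1, hB hp.2.1, hC hp.2.2⟩

lemma measure_rieszSet_le_fst_snd {G : Type*} [MeasurableSpace G] [Add G] (μ : Measure G)
    [SFinite μ] (A B C : Set G) :
    (μ.prod μ) (rieszSet A B C) ≤ μ A * μ B := by
  rw [← measure_fst_snd μ A B]
  exact measure_mono fun p hp => ⟨hp.1, hp.2.1⟩

variable {G : Type*} [MeasurableSpace G] [AddCommGroup G] [MeasurableAdd₂ G]

lemma measurableSet_rieszSet {A B C : Set G} (hA : MeasurableSet A) (hB : MeasurableSet B)
    (hC : MeasurableSet C) : MeasurableSet (rieszSet A B C) :=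
  (measurable_fst hA).inter ((measurable_snd hB).inter ((measurable_fst.add measurable_snd) hC))

variable (μ : Measure G) [SFinite μ] [μ.IsAddLeftInvariant]

lemma measure_fst_add {A C : Set G} (hA : MeasurableSet A) (hC : MeasurableSet C) :
    (μ.prod μ) {p | p.1 ∈ A ∧ p.1 + p.2 ∈ C} = μ A * μ C := by
  rw [← Measure.prod_prod,
    ← (measurePreserving_prod_add μ μ).measure_preimage (hA.prod hC).nullMeasurableSet]
  rfl

lemma measure_snd_add {B C : Set G} (hB : MeasurableSet B) (hC : MeasurableSet C) :
    (μ.prod μ) {p | p.2 ∈ B ∧ p.1 + p.2 ∈ C} = μ B * μ C := by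
  rw [mul_comm, ← Measure.prod_prod,
    ← (measurePreserving_add_prod μ μ).measure_preimage (hC.prod hB).nullMeasurableSet]
  congr 1
  ext p
  exact and_comm

lemma measure_rieszSet_le_fst_add {A C : Set G} (B : Set G) (hA : MeasurableSet A)
    (hC : MeasurableSet C) : (μ.prod μ) (rieszSet A B C) ≤ μ A * μ C := by
  rw [← measure_fst_add μ hA hC]
  exact measure_mono fun p hp => ⟨hp.1, hp.2.2⟩

lemma measure_rieszSet_le_snd_add {B C : Set G} (A : Set G) (hB : MeasurableSet B)
    (hC : MeasurableSet C) : (μ.prod μ) (rieszSet A B C) ≤ μ B * μ C := by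
  rw [← measure_snd_add μ hB hC]
  exact measure_mono fun p hp => ⟨hp.2.1, hp.2.2⟩

end RieszSet

section OneDimensional

/-- The centered open interval of length `c`. -/
def centeredInterval (c : ℝ≥0∞) : Set ℝ := {s | ENNReal.ofReal (2 * |s|) < c}

lemma mem_centeredInterval_ofReal {a s : ℝ} :
    s ∈ centeredInterval (ENNReal.ofReal a) ↔ -(a / 2) < s ∧ s < a / 2 := by
  rw [← abs_lt]
  simp only [centeredInterval, mem_ofPred_eq]
  rw [ENNReal.ofReal_lt_ofReal_iff']
  constructor
  · rintro ⟨h, -⟩; linarith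
  · intro h
    have := abs_nonneg s
    constructor <;> linarith

lemma centeredInterval_ofReal (a : ℝ) :
    centeredInterval (ENNReal.ofReal a) = Ioo (-(a / 2)) (a / 2) := by
  ext s; exact mem_centeredInterval_ofReal

lemma measurableSet_centeredInterval (c : ℝ≥0∞) : MeasurableSet (centeredInterval c) :=
  measurableSet_lt (by fun_prop) measurable_const

lemma volume_centeredInterval {c : ℝ≥0∞} (hc : c ≠ ⊤) : volume (centeredInterval c) = c := by
  obtain ⟨a, ha, rfl⟩ : ∃ a : ℝ, 0 ≤ a ∧ c = ENNReal.ofReal a :=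
    ⟨c.toReal, ENNReal.toReal_nonneg, (ENNReal.ofReal_toReal hc).symm⟩
  rw [centeredInterval_ofReal, Real.volume_Ioo]
  congr 1; ring

lemma exists_volume_inter_Ioi {A : Set ℝ} {a t : ℝ} (hA : MeasurableSet A)
    (ha : volume A = ENNReal.ofReal a) (ht : 0 < t) (hta : t < a) :
    ∃ x, volume (A ∩ Ioi x) = ENNReal.ofReal t ∧ volume (A ∩ Iic x) = ENNReal.ofReal (a - t) := by
  have hfin : ∀ s, volume (A ∩ s) ≠ ⊤ := fun s =>
    ne_top_of_le_ne_top (by rw [ha]; exact ENNReal.ofReal_ne_top) (measure_mono inter_subset_left)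
  have hlip : LipschitzWith 1 fun x => (volume (A ∩ Ioi x)).toReal := by
    refine LipschitzWith.of_le_add fun x y => ?_
    have h : volume (A ∩ Ioi x) ≤ volume (A ∩ Ioi y) + ENNReal.ofReal (dist x y) := by
      calc volume (A ∩ Ioi x) ≤ volume ((A ∩ Ioi y) ∪ Ioc x y) := by
            refine measure_mono fun z hz => ?_
            rcases lt_or_ge y z with h | h
            · exact Or.inl ⟨hz.1, h⟩
            · exact Or.inr ⟨hz.2, h⟩
        _ ≤ volume (A ∩ Ioi y) + volume (Ioc x y) := measure_union_le _ _
        _ ≤ _ := by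
            gcongr
            rw [Real.volume_Ioc]
            exact ENNReal.ofReal_le_ofReal (by rw [dist_comm]; exact le_abs_self _)
    have h2 := ENNReal.toReal_mono (by finiteness [hfin (Ioi y)]) h
    rwa [ENNReal.toReal_add (hfin _) (by finiteness), ENNReal.toReal_ofReal dist_nonneg] at h2
  have hbot : ∃ x, (volume (A ∩ Ioi x)).toReal ≤ t := by
    have h := tendsto_measure_iInter_atTop (μ := volume) (s := fun x : ℝ => A ∩ Ioi x)
      (fun x => (hA.inter measurableSet_Ioi).nullMeasurableSet)
      (fun x y hxy => inter_subset_inter_right _ (Ioi_subset_Ioi hxy)) ⟨0, hfin _⟩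
    have he : ⋂ x : ℝ, A ∩ Ioi x = ∅ := by
      ext z
      simp only [mem_iInter, mem_empty_iff_false, iff_false, not_forall]
      exact ⟨z, fun h => lt_irrefl z h.2⟩
    rw [he, measure_empty] at h
    obtain ⟨x, hx⟩ := (h.eventually (gt_mem_nhds (ENNReal.ofReal_pos.2 ht))).exists
    refine ⟨x, ?_⟩
    exact ENNReal.toReal_le_of_le_ofReal ht.le hx.le
  have htop : ∃ x, t ≤ (volume (A ∩ Ioi x)).toReal := by
    have h := tendsto_measure_iUnion_atTop (μ := volume) (s := fun x : ℝ => A ∩ Ioi (-x))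
      (fun x y hxy => inter_subset_inter_right _ (Ioi_subset_Ioi (neg_le_neg hxy)))
    have he : ⋃ x : ℝ, A ∩ Ioi (-x) = A := by
      ext z
      simp only [mem_iUnion]
      exact ⟨fun ⟨_, h⟩ => h.1, fun h => ⟨-z + 1, h, by simp⟩⟩
    rw [he, ha] at h
    obtain ⟨x, hx⟩ := (h.eventually (lt_mem_nhds
      ((ENNReal.ofReal_lt_ofReal_iff (ht.trans hta)).2 hta))).exists
    exact ⟨-x, (ENNReal.ofReal_le_iff_le_toReal (hfin _)).1 hx.le⟩
  obtain ⟨x, hx⟩ := mem_range_of_exists_le_of_exists_ge hlip.continuous hbot htop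
  have hx' : volume (A ∩ Ioi x) = ENNReal.ofReal t := by
    rw [← hx, ENNReal.ofReal_toReal (hfin _)]
  refine ⟨x, hx', ?_⟩
  have h := measure_inter_add_sdiff A (measurableSet_Ioi (a := x)) (μ := volume)
  rw [sdiff_eq, compl_Ioi, hx', ha, ← add_sub_cancel t a,
    ENNReal.ofReal_add ht.le (by linarith)] at h
  simpa using (ENNReal.add_right_inj ENNReal.ofReal_ne_top).1 h

/-- A dual form of Pollard's inequality on the line. -/
lemma volume_rieszSet_le {A B C : Set ℝ} {a b t : ℝ} (hA : MeasurableSet A) (hB : MeasurableSet B)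
    (hC : MeasurableSet C) (ha : volume A = ENNReal.ofReal a) (hb : volume B = ENNReal.ofReal b)
    (ht : 0 < t) (hta : t < a) (htb : t < b) :
    volume (rieszSet A B C) ≤
      ENNReal.ofReal (a - t) * ENNReal.ofReal (b - t) + ENNReal.ofReal t * volume C := by
  obtain ⟨x, hx1, hx2⟩ := exists_volume_inter_Ioi hA ha ht hta
  obtain ⟨y, hy1, hy2⟩ := exists_volume_inter_Ioi hB hb (t := b - t) (by linarith) (by linarith)
  rw [show b - (b - t) = t by ring] at hy2
  have hsub : rieszSet A B C ⊆ rieszSet (A ∩ Iic x) (B ∩ Ioi y) univ ∪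
      (rieszSet (A ∩ Ioi x) univ (C ∩ Ioi (x + y)) ∪
        rieszSet univ (B ∩ Iic y) (C ∩ Iic (x + y))) := by
    rintro ⟨p, q⟩ ⟨hp, hq, hpq⟩
    simp only [rieszSet, mem_union, mem_ofPred_eq, mem_inter_iff, mem_Iic, mem_Ioi, mem_univ] at *
    by_cases h1 : p ≤ x <;> by_cases h2 : y < q <;> by_cases h3 : p + q ≤ x + y <;>
      simp_all <;> grind
  refine (measure_mono hsub).trans ?_
  refine (measure_union_le _ _).trans ?_
  refine add_le_add ?_ ((measure_union_le _ _).trans ?_)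
  · rw [← hx2, ← hy1]
    exact measure_rieszSet_le_fst_snd volume _ _ _
  · calc _ ≤ volume (A ∩ Ioi x) * volume (C ∩ Ioi (x + y)) +
          volume (B ∩ Iic y) * volume (C ∩ Iic (x + y)) :=
        add_le_add
          (measure_rieszSet_le_fst_add volume _ (hA.inter measurableSet_Ioi)
            (hC.inter measurableSet_Ioi))
          (measure_rieszSet_le_snd_add volume _ (hB.inter measurableSet_Iic)
            (hC.inter measurableSet_Iic))
      _ = ENNReal.ofReal t * volume C := by
        rw [hx1, hy2, ← mul_add, ← measure_inter_add_sdiff C (measurableSet_Ioi (a := x + y)),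
          sdiff_eq, compl_Ioi]

lemma le_volume_rieszSet_centeredInterval {a b c t : ℝ} (ht : 0 < t) (hta : t < a) (htb : t < b)
    (hc : c = a + b - 2 * t) :
    ENNReal.ofReal (a - t) * ENNReal.ofReal (b - t) + ENNReal.ofReal t * ENNReal.ofReal c ≤
      volume (rieszSet (centeredInterval (ENNReal.ofReal a)) (centeredInterval (ENNReal.ofReal b))
        (centeredInterval (ENNReal.ofReal c))) := by
  set x := a / 2 - t
  set y := -(b / 2) + t
  have h1 : volume {p : ℝ × ℝ | p.1 ∈ Ioc (-(a / 2)) x ∧ p.2 ∈ Ioo y (b / 2)} =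
      ENNReal.ofReal (a - t) * ENNReal.ofReal (b - t) := by
    rw [show (volume : Measure (ℝ × ℝ)) = (volume : Measure ℝ).prod volume from rfl,
      measure_fst_snd, Real.volume_Ioc, Real.volume_Ioo]
    congr 2 <;> simp only [x, y] <;> ring
  have h2 : volume {p : ℝ × ℝ | p.1 ∈ Ioo x (a / 2) ∧ p.1 + p.2 ∈ Ioo (x + y) (c / 2)} =
      ENNReal.ofReal t * ENNReal.ofReal (b - t) := by
    rw [show (volume : Measure (ℝ × ℝ)) = (volume : Measure ℝ).prod volume from rfl,
      measure_fst_add _ measurableSet_Ioo measurableSet_Ioo, Real.volume_Ioo, Real.volume_Ioo]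
    congr 2 <;> simp only [x, y, hc] <;> ring
  have h3 : volume {p : ℝ × ℝ | p.2 ∈ Ioc (-(b / 2)) y ∧ p.1 + p.2 ∈ Ioc (-(c / 2)) (x + y)} =
      ENNReal.ofReal t * ENNReal.ofReal (a - t) := by
    rw [show (volume : Measure (ℝ × ℝ)) = (volume : Measure ℝ).prod volume from rfl,
      measure_snd_add _ measurableSet_Ioc measurableSet_Ioc, Real.volume_Ioc, Real.volume_Ioc]
    congr 2 <;> simp only [x, y, hc] <;> ring
  have e : ENNReal.ofReal (a - t) * ENNReal.ofReal (b - t) + ENNReal.ofReal t * ENNReal.ofReal c =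
      ENNReal.ofReal (a - t) * ENNReal.ofReal (b - t) + (ENNReal.ofReal t * ENNReal.ofReal (b - t)
        + ENNReal.ofReal t * ENNReal.ofReal (a - t)) := by
    rw [← mul_add, ← ENNReal.ofReal_add (by linarith) (by linarith)]
    congr 3; linarith
  have hm3 : MeasurableSet
      {p : ℝ × ℝ | p.2 ∈ Ioc (-(b / 2)) y ∧ p.1 + p.2 ∈ Ioc (-(c / 2)) (x + y)} :=
    (measurable_snd measurableSet_Ioc).inter
      ((measurable_fst.add measurable_snd) measurableSet_Ioc)
  have hm2 : MeasurableSet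
      {p : ℝ × ℝ | p.1 ∈ Ioo x (a / 2) ∧ p.1 + p.2 ∈ Ioo (x + y) (c / 2)} :=
    (measurable_fst measurableSet_Ioo).inter
      ((measurable_fst.add measurable_snd) measurableSet_Ioo)
  rw [e, ← h1, ← h2, ← h3, ← measure_union _ hm3, ← measure_union _ (hm2.union hm3)]
  · refine measure_mono ?_
    rintro ⟨p, q⟩ h
    simp only [mem_union, mem_ofPred_eq, mem_Ioc, mem_Ioo, x, y] at h
    simp only [rieszSet, mem_ofPred_eq, mem_centeredInterval_ofReal]
    rcases h with h | h | h <;> refine ⟨⟨?_, ?_⟩, ⟨?_, ?_⟩, ?_, ?_⟩ <;> linarith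
  · rw [Set.disjoint_left]
    rintro ⟨p, q⟩ h h'
    simp only [mem_union, mem_ofPred_eq, mem_Ioc, mem_Ioo] at h h'
    rcases h' with h' | h' <;> linarith
  · rw [Set.disjoint_left]
    rintro ⟨p, q⟩ h h'
    simp only [mem_ofPred_eq, mem_Ioc, mem_Ioo] at h h'
    linarith

/-- The Riesz rearrangement inequality for sets on the line. -/
lemma volume_rieszSet_le_centeredInterval {A B C : Set ℝ} (hA : MeasurableSet A)
    (hB : MeasurableSet B) (hC : MeasurableSet C) (hA' : volume A ≠ ⊤) (hB' : volume B ≠ ⊤)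
    (hC' : volume C ≠ ⊤) :
    volume (rieszSet A B C) ≤ volume (rieszSet (centeredInterval (volume A))
      (centeredInterval (volume B)) (centeredInterval (volume C))) := by
  have key : ∀ X : Set ℝ, volume X ≠ ⊤ → ∃ a : ℝ, 0 ≤ a ∧ volume X = ENNReal.ofReal a :=
    fun X hX => ⟨_, ENNReal.toReal_nonneg, (ENNReal.ofReal_toReal hX).symm⟩
  obtain ⟨a, ha0, ha⟩ := key A hA'
  obtain ⟨b, hb0, hb⟩ := key B hB'
  obtain ⟨c, hc0, hc⟩ := key C hC'
  have hvol : ∀ X : Set ℝ, volume X ≠ ⊤ → volume (centeredInterval (volume X)) = volume X :=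
    fun X hX => volume_centeredInterval hX
  by_cases h1 : a + b ≤ c
  · refine (measure_rieszSet_le_fst_snd volume A B C).trans ?_
    rw [← hvol A hA', ← hvol B hB', ← measure_fst_snd, hvol A hA', hvol B hB']
    refine measure_mono ?_
    rintro ⟨p, q⟩ ⟨hp, hq⟩
    refine ⟨hp, hq, ?_⟩
    simp only [ha, hb, hc, mem_centeredInterval_ofReal] at *
    constructor <;> linarith
  by_cases h2 : a + c ≤ b
  · refine (measure_rieszSet_le_fst_add volume B hA hC).trans ?_
    rw [← hvol A hA', ← hvol C hC', ← measure_fst_add _ (measurableSet_centeredInterval _)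
      (measurableSet_centeredInterval _), hvol A hA', hvol C hC']
    refine measure_mono ?_
    rintro ⟨p, q⟩ ⟨hp, hq⟩
    refine ⟨hp, ?_, hq⟩
    simp only [ha, hb, hc, mem_centeredInterval_ofReal] at *
    constructor <;> linarith
  by_cases h3 : b + c ≤ a
  · refine (measure_rieszSet_le_snd_add volume A hB hC).trans ?_
    rw [← hvol B hB', ← hvol C hC', ← measure_snd_add _ (measurableSet_centeredInterval _)
      (measurableSet_centeredInterval _), hvol B hB', hvol C hC']
    refine measure_mono ?_
    rintro ⟨p, q⟩ ⟨hp, hq⟩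
    refine ⟨?_, hp, hq⟩
    simp only [ha, hb, hc, mem_centeredInterval_ofReal] at *
    constructor <;> linarith
  have ht : 0 < (a + b - c) / 2 := by linarith
  refine (volume_rieszSet_le hA hB hC ha hb ht (by linarith) (by linarith)).trans ?_
  rw [ha, hb, hc]
  exact le_volume_rieszSet_centeredInterval ht (by linarith) (by linarith) (by ring)

end OneDimensional

section SteinerProd

lemma measure_prod_prod {α β : Type*} [MeasurableSpace α] [MeasurableSpace β] (μ : Measure α)
    (ν : Measure β) [SFinite μ] [SFinite ν] {S : Set ((α × β) × (α × β))} (hS : MeasurableSet S) :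
    ((μ.prod ν).prod (μ.prod ν)) S =
      ∫⁻ η, ∫⁻ ζ, (μ.prod μ) {q : α × α | ((q.1, η), (q.2, ζ)) ∈ S} ∂ν ∂ν := by
  have hm : Measurable (S.indicator (1 : (α × β) × (α × β) → ℝ≥0∞)) := measurable_one.indicator hS
  rw [← lintegral_indicator_one hS, lintegral_prod _ hm.aemeasurable,
    lintegral_prod_symm _ hm.lintegral_prod_right'.aemeasurable]
  refine lintegral_congr fun η => ?_
  have h1 : ∀ s, ∫⁻ q, S.indicator (1 : (α × β) × (α × β) → ℝ≥0∞) ((s, η), q) ∂(μ.prod ν) =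
      ∫⁻ ζ, ∫⁻ t, S.indicator (1 : (α × β) × (α × β) → ℝ≥0∞) ((s, η), (t, ζ)) ∂μ ∂ν := fun s =>
    lintegral_prod_symm _ (hm.comp (by fun_prop)).aemeasurable
  simp_rw [h1]
  have hm2 : Measurable fun p : (α × β) × α =>
      S.indicator (1 : (α × β) × (α × β) → ℝ≥0∞) ((p.1.1, η), (p.2, p.1.2)) := hm.comp (by fun_prop)
  rw [lintegral_lintegral_swap hm2.lintegral_prod_right'.aemeasurable]
  refine lintegral_congr fun ζ => ?_
  have hmT : Measurable fun q : α × α => ((q.1, η), (q.2, ζ)) := by fun_prop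
  have hT : MeasurableSet {q : α × α | ((q.1, η), (q.2, ζ)) ∈ S} := hmT hS
  rw [← lintegral_indicator_one hT, lintegral_prod _ (measurable_one.indicator hT).aemeasurable]
  rfl

variable {F : Type*}

/-- The sections of a subset of `ℝ × F` along the first coordinate. -/
def lineSection (A : Set (ℝ × F)) (y : F) : Set ℝ := {s | (s, y) ∈ A}

/-- Steiner symmetrization in `ℝ × F` along the first coordinate. -/
def steinerProd (A : Set (ℝ × F)) : Set (ℝ × F) :=
  {p | p.1 ∈ centeredInterval (volume (lineSection A p.2))}

/-- A set whose sections along the first coordinate are centered intervals. -/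
def LineBalanced (K : Set (ℝ × F)) : Prop :=
  ∀ ⦃s s' y⦄, |s'| ≤ |s| → (s, y) ∈ K → (s', y) ∈ K

lemma steinerProd_subset {A K : Set (ℝ × F)} (hK : LineBalanced K) (hA : A ⊆ K) :
    steinerProd A ⊆ K := by
  rintro ⟨s, y⟩ h
  by_contra hs
  have h1 : lineSection A y ⊆ Ioo (-|s|) |s| := fun s' hs' => by
    by_contra h2
    rw [mem_Ioo, ← abs_lt, not_lt] at h2
    exact hs (hK h2 (hA hs'))
  have h2 := measure_mono (μ := volume) h1
  rw [Real.volume_Ioo, sub_neg_eq_add, ← two_mul] at h2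
  exact not_lt_of_ge h2 h

lemma volume_inter_add_le {X K : Set ℝ} (hX : MeasurableSet X) (hXfin : volume X ≠ ⊤)
    (hK : MeasurableSet K) (hK' : ∀ ⦃s s'⦄, |s'| ≤ |s| → s ∈ K → s' ∈ K) (c : ℝ) :
    volume (X ∩ K) + volume {s | s ∈ X \ K ∧ s + c ∈ K \ X} ≤
      volume (centeredInterval (volume X) ∩ K) := by
  have hE : MeasurableSet {s | s ∈ X \ K ∧ s + c ∈ K \ X} :=
    (hX.diff hK).inter ((measurable_id.add_const c) (hK.diff hX))
  by_cases h : ∃ s ∈ K, s ∉ centeredInterval (volume X)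
  · obtain ⟨s, hs, hs'⟩ := h
    have hsub : centeredInterval (volume X) ⊆ K := fun s' h' => by
      refine hK' ?_ hs
      by_contra! hlt
      refine hs' (lt_of_le_of_lt (b := ENNReal.ofReal (2 * |s'|)) ?_ h' :
        ENNReal.ofReal (2 * |s|) < volume X)
      exact ENNReal.ofReal_le_ofReal (by linarith)
    rw [inter_eq_self_of_subset_left hsub, volume_centeredInterval hXfin, ← measure_union _ hE]
    · refine measure_mono ?_
      rintro s (hs | hs)
      exacts [hs.1, hs.1.1]
    · exact Set.disjoint_left.2 fun s h1 h2 => h2.1.2 h1.2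
  · push Not at h
    rw [inter_eq_self_of_subset_right (s := centeredInterval _) h]
    have htr : volume {s | s ∈ X \ K ∧ s + c ∈ K \ X} ≤ volume (K \ X) := by
      rw [← measure_preimage_add_right volume c (K \ X)]
      exact measure_mono fun s hs => hs.2
    calc _ ≤ volume (X ∩ K) + volume (K \ X) := by gcongr
      _ = volume K := by rw [inter_comm, measure_inter_add_sdiff K hX]

variable [MeasurableSpace F]

lemma measurableSet_lineSection {A : Set (ℝ × F)} (hA : MeasurableSet A) (y : F) :
    MeasurableSet (lineSection A y) := measurable_prodMk_right hA

lemma measurableSet_steinerProd {A : Set (ℝ × F)} (hA : MeasurableSet A) :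
    MeasurableSet (steinerProd A) :=
  measurableSet_lt (by fun_prop) ((measurable_measure_prodMk_right hA).comp measurable_snd)

variable (ν : Measure F) [SFinite ν]

lemma measure_eq_lintegral_lineSection {A : Set (ℝ × F)} (hA : MeasurableSet A) :
    ((volume : Measure ℝ).prod ν) A = ∫⁻ y, volume (lineSection A y) ∂ν :=
  Measure.prod_apply_symm hA

lemma measure_steinerProd {A : Set (ℝ × F)} (hA : MeasurableSet A)
    (hA' : ∀ y, volume (lineSection A y) ≠ ⊤) :
    ((volume : Measure ℝ).prod ν) (steinerProd A) = ((volume : Measure ℝ).prod ν) A := by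
  rw [measure_eq_lintegral_lineSection ν hA,
    measure_eq_lintegral_lineSection ν (measurableSet_steinerProd hA)]
  exact lintegral_congr fun y => volume_centeredInterval (hA' y)

lemma measure_inter_add_le_steinerProd {A K : Set (ℝ × F)} (hA : MeasurableSet A)
    (hA' : ∀ y, volume (lineSection A y) ≠ ⊤) (hK : MeasurableSet K) (hK' : LineBalanced K)
    (c : ℝ) :
    ((volume : Measure ℝ).prod ν) (A ∩ K) +
        ((volume : Measure ℝ).prod ν) {p | p ∈ A \ K ∧ (p.1 + c, p.2) ∈ K \ A} ≤
      ((volume : Measure ℝ).prod ν) (steinerProd A ∩ K) := by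
  have hm : Measurable fun p : ℝ × F => (p.1 + c, p.2) := by fun_prop
  have hE : MeasurableSet {p : ℝ × F | p ∈ A \ K ∧ (p.1 + c, p.2) ∈ K \ A} :=
    (hA.diff hK).inter (hm (hK.diff hA))
  rw [measure_eq_lintegral_lineSection ν (hA.inter hK), measure_eq_lintegral_lineSection ν hE,
    measure_eq_lintegral_lineSection ν ((measurableSet_steinerProd hA).inter hK),
    ← lintegral_add_left (f := fun y => volume (lineSection (A ∩ K) y))
      (measurable_measure_prodMk_right (hA.inter hK))]
  exact lintegral_mono fun y => volume_inter_add_le (measurableSet_lineSection hA y) (hA' y)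
    (measurableSet_lineSection hK y) (fun _ _ h => hK' h) c

lemma measure_rieszSet_le_steinerProd [AddCommGroup F] [MeasurableAdd₂ F] {A B C : Set (ℝ × F)}
    (hA : MeasurableSet A) (hB : MeasurableSet B) (hC : MeasurableSet C)
    (hA' : ∀ y, volume (lineSection A y) ≠ ⊤) (hB' : ∀ y, volume (lineSection B y) ≠ ⊤)
    (hC' : ∀ y, volume (lineSection C y) ≠ ⊤) :
    (((volume : Measure ℝ).prod ν).prod ((volume : Measure ℝ).prod ν)) (rieszSet A B C) ≤
      (((volume : Measure ℝ).prod ν).prod ((volume : Measure ℝ).prod ν))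
        (rieszSet (steinerProd A) (steinerProd B) (steinerProd C)) := by
  have : MeasurableAdd₂ (ℝ × F) := ⟨((measurable_fst.comp measurable_fst).add
    (measurable_fst.comp measurable_snd)).prodMk ((measurable_snd.comp measurable_fst).add
    (measurable_snd.comp measurable_snd))⟩
  rw [measure_prod_prod _ _ (measurableSet_rieszSet hA hB hC),
    measure_prod_prod _ _ (measurableSet_rieszSet (measurableSet_steinerProd hA)
      (measurableSet_steinerProd hB) (measurableSet_steinerProd hC))]
  exact lintegral_mono fun η => lintegral_mono fun ζ =>
    volume_rieszSet_le_centeredInterval (measurableSet_lineSection hA η)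
      (measurableSet_lineSection hB ζ) (measurableSet_lineSection hC (η + ζ))
      (hA' η) (hB' ζ) (hC' (η + ζ))

end SteinerProd

section Steiner

/-- Measure preserving linear coordinates on `ℝⁿ` whose first axis is directed along `v`. -/
lemma exists_axis_coordinates {n : ℕ} {v : EuclideanSpace ℝ (Fin n)} (hv : v ≠ 0) :
    ∃ (m : ℕ) (T : EuclideanSpace ℝ (Fin n) ≃ᵐ ℝ × (Fin m → ℝ)) (c : ℝ) (q : (Fin m → ℝ) → ℝ),
      MeasurePreserving T volume ((volume : Measure ℝ).prod volume) ∧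
      (∀ x y, T (x + y) = T x + T y) ∧ T v = (c, 0) ∧ (∀ y, 0 ≤ q y) ∧
      ∀ x, ‖x‖ ^ 2 = (T x).1 ^ 2 + q (T x).2 := by
  obtain _ | m := n
  · exact absurd (Subsingleton.elim v 0) hv
  have hnv : ‖v‖ ≠ 0 := norm_ne_zero_iff.2 hv
  obtain ⟨b, hb⟩ := Orthonormal.exists_orthonormalBasis_extension_of_card_eq (𝕜 := ℝ)
    (E := EuclideanSpace ℝ (Fin (m + 1))) (ι := Fin (m + 1)) (by simp)
    (v := fun _ => ‖v‖⁻¹ • v) (s := {0}) (by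
      rw [orthonormal_subsingleton_iff]
      rintro ⟨i, hi⟩
      simp [Set.domRestrict, norm_smul, hnv])
  have hb0 : b 0 = ‖v‖⁻¹ • v := hb 0 rfl
  let T := (b.repr.toHomeomorph.toMeasurableEquiv.trans
    (MeasurableEquiv.toLp 2 (Fin (m + 1) → ℝ)).symm).trans
      (MeasurableEquiv.piFinSuccAbove (fun _ => ℝ) 0)
  have hT1 : ∀ x, (T x).1 = b.repr x 0 := fun x => rfl
  have hT2 : ∀ x i, (T x).2 i = b.repr x i.succ := fun x i => rfl
  refine ⟨m, T, ‖v‖, fun y => ∑ i, y i ^ 2, ?_, ?_, ?_, ?_, ?_⟩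
  · exact (volume_preserving_piFinSuccAbove (fun _ => ℝ) 0).comp
      ((PiLp.volume_preserving_ofLp _).comp b.repr.measurePreserving)
  · intro x y
    refine Prod.ext ?_ (funext fun i => ?_)
    · simp [hT1]
    · simp [hT2]
  · have hvb : v = ‖v‖ • b 0 := by rw [hb0, smul_smul, mul_inv_cancel₀ hnv, one_smul]
    have hr : ∀ i, b.repr v i = if i = 0 then ‖v‖ else 0 := fun i => by
      conv_lhs => rw [hvb]
      simp
    refine Prod.ext ?_ (funext fun i => ?_)
    · simp [hT1, hr]
    · simp [hT2, hr]
  · exact fun y => Finset.sum_nonneg fun i _ => sq_nonneg _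
  · intro x
    rw [← b.repr.norm_map x, EuclideanSpace.norm_sq_eq, Fin.sum_univ_succ]
    simp [hT1, hT2]

/-- A set that contains, with every point, all points of smaller norm. -/
def IsCentered {E : Type*} [Norm E] (K : Set E) : Prop :=
  ∀ ⦃x y⦄, ‖y‖ ≤ ‖x‖ → x ∈ K → y ∈ K

/-- Existence of Steiner symmetrization along `v`. -/
lemma exists_steiner {n : ℕ} {v : EuclideanSpace ℝ (Fin n)} (hv : v ≠ 0) (R : ℝ) :
    ∃ S : Set (EuclideanSpace ℝ (Fin n)) → Set (EuclideanSpace ℝ (Fin n)),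
      (∀ A, MeasurableSet A → A ⊆ Metric.ball 0 R →
        MeasurableSet (S A) ∧ S A ⊆ Metric.ball 0 R ∧ volume (S A) = volume A ∧
        ∀ K, MeasurableSet K → IsCentered K →
          volume (A ∩ K) + volume {x | x ∈ A \ K ∧ x + v ∈ K \ A} ≤ volume (S A ∩ K)) ∧
      ∀ A B C, MeasurableSet A → MeasurableSet B → MeasurableSet C → A ⊆ Metric.ball 0 R →
        B ⊆ Metric.ball 0 R → C ⊆ Metric.ball 0 R →
        volume (rieszSet A B C) ≤ volume (rieszSet (S A) (S B) (S C)) := by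
  obtain ⟨m, T, c, q, hT, hadd, hTv, hq, hnorm⟩ := exists_axis_coordinates hv
  have hmeas : ∀ A, MeasurableSet A → MeasurableSet (T '' A) := fun A hA =>
    T.measurableSet_image.2 hA
  have hbal : ∀ K, IsCentered K → LineBalanced (T '' K) := by
    rintro K hK s s' y hs ⟨x, hx, hxs⟩
    refine ⟨T.symm (s', y), hK ?_ hx, T.apply_symm_apply _⟩
    rw [← sq_le_sq₀ (norm_nonneg _) (norm_nonneg _), hnorm, hnorm x, T.apply_symm_apply, hxs]
    have := sq_le_sq.2 hs
    simpa using this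
  have hballC : IsCentered (Metric.ball (0 : EuclideanSpace ℝ (Fin n)) R) := fun x y h hx => by
    rw [mem_ball_zero_iff] at *
    exact h.trans_lt hx
  have hfin : ∀ A, A ⊆ Metric.ball 0 R → ∀ y, volume (lineSection (T '' A) y) ≠ ⊤ := by
    intro A hA y
    refine ne_top_of_le_ne_top (b := volume (Ioo (-R) R)) (by rw [Real.volume_Ioo]; finiteness)
      (measure_mono ?_)
    rintro s ⟨x, hx, hxs⟩
    have h1 := hA hx
    rw [mem_ball_zero_iff] at h1
    have h2 := hnorm x
    rw [hxs] at h2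
    rw [mem_Ioo, ← abs_lt]
    refine lt_of_le_of_lt (abs_le_of_sq_le_sq' ?_ (norm_nonneg x) |> abs_le.2) h1
    have := hq y
    simp only at h2
    linarith
  have hvol : ∀ B, volume (T ⁻¹' B) = ((volume : Measure ℝ).prod volume) B :=
    fun B => hT.measure_preimage_equiv B
  have hpre : ∀ A, T ⁻¹' (T '' A) = A := fun A => preimage_image_eq A T.injective
  have hvolimg : ∀ A, ((volume : Measure ℝ).prod volume) (T '' A) = volume A := fun A => by
    rw [← hvol, hpre]
  let TT := MeasurableEquiv.prodCongr T T
  have hTT : MeasurePreserving TT volume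
      (((volume : Measure ℝ).prod (volume : Measure (Fin m → ℝ))).prod
        ((volume : Measure ℝ).prod volume)) := hT.prod hT
  have hriesz : ∀ A B C, volume (rieszSet (T ⁻¹' A) (T ⁻¹' B) (T ⁻¹' C)) =
      (((volume : Measure ℝ).prod (volume : Measure (Fin m → ℝ))).prod
        ((volume : Measure ℝ).prod volume)) (rieszSet A B C) := fun A B C => by
    rw [← hTT.measure_preimage_equiv]
    congr 1
    ext p
    simp only [rieszSet, mem_preimage, mem_ofPred_eq, hadd]
    rfl
  refine ⟨fun A => T ⁻¹' (steinerProd (T '' A)), fun A hA hAR => ⟨?_, ?_, ?_, ?_⟩, ?_⟩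
  · exact T.measurable (measurableSet_steinerProd (hmeas A hA))
  · rw [← hpre (Metric.ball 0 R)]
    exact preimage_mono (steinerProd_subset (hbal _ hballC) (image_mono hAR))
  · rw [hvol, measure_steinerProd _ (hmeas A hA) (hfin A hAR), hvolimg]
  · intro K hK hKc
    have h := measure_inter_add_le_steinerProd (volume : Measure (Fin m → ℝ)) (hmeas A hA)
      (hfin A hAR) (hmeas K hK) (hbal K hKc) c
    rw [← hvol, ← hvol, ← hvol, preimage_inter, preimage_inter, hpre, hpre] at h
    refine le_trans (le_of_eq ?_) h
    congr 2
    ext x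
    have : ((T x).1 + c, (T x).2) = T (x + v) := by rw [hadd, hTv]; ext <;> simp
    simp only [mem_preimage, mem_ofPred_eq, Set.mem_sdiff, this, T.injective.mem_set_image]
  · intro A B C hA hB hC hAR hBR hCR
    simp only
    rw [hriesz]
    refine le_trans (le_of_eq ?_) (measure_rieszSet_le_steinerProd _ (hmeas A hA) (hmeas B hB)
      (hmeas C hC) (hfin A hAR) (hfin B hBR) (hfin C hCR))
    rw [← hriesz, hpre, hpre, hpre]

end Steiner

section BallRearrange

variable {n : ℕ}

lemma isCentered_ballRearrange (A : Set (EuclideanSpace ℝ (Fin n))) :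
    IsCentered (ballRearrange n A) :=
  fun _ _ h hx => (measure_mono (Metric.ball_subset_ball h)).trans_lt hx

lemma measurable_volume_ball_norm :
    Measurable fun x : EuclideanSpace ℝ (Fin n) =>
      volume (Metric.ball (0 : EuclideanSpace ℝ (Fin n)) ‖x‖) :=
  (Monotone.measurable fun _ _ h => measure_mono (Metric.ball_subset_ball h)).comp measurable_norm

lemma measurableSet_ballRearrange (A : Set (EuclideanSpace ℝ (Fin n))) :
    MeasurableSet (ballRearrange n A) :=
  measurableSet_lt measurable_volume_ball_norm measurable_const

lemma ballRearrange_mono {A B : Set (EuclideanSpace ℝ (Fin n))} (h : volume A ≤ volume B) :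
    ballRearrange n A ⊆ ballRearrange n B :=
  fun _ hx => lt_of_lt_of_le hx h

lemma ballRearrange_subset_ball {A : Set (EuclideanSpace ℝ (Fin n))} {R : ℝ}
    (h : A ⊆ Metric.ball 0 R) : ballRearrange n A ⊆ Metric.ball 0 R := by
  intro x hx
  by_contra hxR
  rw [mem_ball_zero_iff, not_lt] at hxR
  exact lt_irrefl _ (lt_of_lt_of_le hx (measure_mono (h.trans (Metric.ball_subset_ball hxR))))

lemma volume_ballRearrange (A : Set (EuclideanSpace ℝ (Fin n))) :
    volume (ballRearrange n A) = volume A := by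
  obtain _ | m := n
  · have hb : ∀ x : EuclideanSpace ℝ (Fin 0), Metric.ball (0 : EuclideanSpace ℝ (Fin 0)) ‖x‖ = ∅ :=
      fun x => by rw [Subsingleton.elim x 0, norm_zero, Metric.ball_zero]
    rcases A.eq_empty_or_nonempty with rfl | hA
    · have : ballRearrange 0 ∅ = ∅ := by ext x; simp [ballRearrange]
      rw [this]
    · rw [(Subsingleton.eq_univ_of_nonempty hA : A = univ)]
      congr 1
      refine eq_univ_of_forall fun x => ?_
      simp only [ballRearrange, mem_ofPred_eq, hb, measure_empty]
      exact isOpen_univ.measure_pos volume univ_nonempty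
  set V := volume (Metric.ball (0 : EuclideanSpace ℝ (Fin (m + 1))) 1) with hV
  have hV0 : V ≠ 0 := (Metric.measure_ball_pos volume _ one_pos).ne'
  have hVt : V ≠ ⊤ := measure_ball_lt_top.ne
  have hball : ∀ r : ℝ, 0 ≤ r → volume (Metric.ball (0 : EuclideanSpace ℝ (Fin (m + 1))) r) =
      ENNReal.ofReal (r ^ (m + 1)) * V := fun r hr => by
    rw [Measure.addHaar_ball volume 0 hr, finrank_euclideanSpace_fin]
  by_cases hA : volume A = ⊤
  · have : ballRearrange (m + 1) A = univ := by
      refine eq_univ_of_forall fun x => ?_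
      simp only [ballRearrange, mem_ofPred_eq, hA]
      exact measure_ball_lt_top
    rw [this, hA]
    exact measure_univ_of_isAddLeftInvariant volume
  · set a := (volume A / V).toReal with ha
    have ha0 : 0 ≤ a := ENNReal.toReal_nonneg
    have haV : ENNReal.ofReal a * V = volume A := by
      rw [ENNReal.ofReal_toReal (ENNReal.div_ne_top hA hV0), ENNReal.div_mul_cancel hV0 hVt]
    set r := a ^ ((m + 1 : ℕ) : ℝ)⁻¹ with hr
    have hr0 : 0 ≤ r := Real.rpow_nonneg ha0 _
    have hra : r ^ (m + 1) = a := Real.rpow_inv_natCast_pow ha0 (Nat.succ_ne_zero m)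
    have : ballRearrange (m + 1) A = Metric.ball 0 r := by
      ext x
      simp only [ballRearrange, mem_ofPred_eq, mem_ball_zero_iff]
      rw [hball _ (norm_nonneg x), ← haV, ENNReal.mul_lt_mul_iff_left hV0 hVt,
        ENNReal.ofReal_lt_ofReal_iff_of_nonneg (by positivity), ← hra,
        pow_lt_pow_iff_left₀ (norm_nonneg x) hr0 (Nat.succ_ne_zero m)]
    rw [this, hball r hr0, hra, haV]

end BallRearrange

section Riesz

variable {n : ℕ}

lemma lintegral_measure_translate {X Y : Set (EuclideanSpace ℝ (Fin n))} (hX : MeasurableSet X)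
    (hY : MeasurableSet Y) : ∫⁻ v, volume {x | x ∈ X ∧ x + v ∈ Y} = volume X * volume Y := by
  rw [← measure_snd_add volume hX hY, Measure.prod_apply]
  · refine lintegral_congr fun v => ?_
    congr 1
    ext x
    simp [add_comm]
  · exact (measurable_snd hX).inter ((measurable_fst.add measurable_snd) hY)

lemma measurable_measure_translate {X Y : Set (EuclideanSpace ℝ (Fin n))} (hX : MeasurableSet X)
    (hY : MeasurableSet Y) : Measurable fun v => volume {x | x ∈ X ∧ x + v ∈ Y} :=
  measurable_measure_prodMk_left (s := {p : EuclideanSpace ℝ (Fin n) × _ |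
    p.2 ∈ X ∧ p.2 + p.1 ∈ Y})
    ((measurable_snd hX).inter ((measurable_snd.add measurable_fst) hY))

lemma volume_sdiff_comm {α : Type*} [MeasurableSpace α] {μ : Measure α} {A K : Set α}
    (hA : MeasurableSet A)
    (hK : MeasurableSet K) (h : μ A = μ K) (hfin : μ A ≠ ⊤) :
    μ (A \ K) = μ (K \ A) := by
  have h1 := measure_inter_add_sdiff A hK (μ := μ)
  have h2 := measure_inter_add_sdiff K hA (μ := μ)
  rw [inter_comm, ← h, ← h1] at h2
  refine ((ENNReal.add_right_inj ?_).1 h2).symm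
  exact ne_top_of_le_ne_top hfin (measure_mono inter_subset_left)

lemma volume_rieszSet_le_add_sdiff {A B C K L M : Set (EuclideanSpace ℝ (Fin n))}
    (hA : MeasurableSet A) (hC : MeasurableSet C) (hM : MeasurableSet M) {V : ℝ≥0∞}
    (hAV : volume A ≤ V) (hBV : volume B ≤ V) :
    volume (rieszSet A B C) ≤ volume (rieszSet K L M) +
      (volume (A \ K) + volume (B \ L) + volume (C \ M)) * V := by
  have hsub : rieszSet A B C ⊆ rieszSet K L M ∪ (rieszSet (A \ K) B C ∪
      (rieszSet A (B \ L) C ∪ rieszSet A B (C \ M))) := by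
    rintro ⟨p, q⟩ ⟨h1, h2, h3⟩
    by_cases hp : p ∈ K
    · by_cases hq : q ∈ L
      · by_cases hpq : p + q ∈ M
        · exact Or.inl ⟨hp, hq, hpq⟩
        · exact Or.inr (Or.inr (Or.inr ⟨h1, h2, h3, hpq⟩))
      · exact Or.inr (Or.inr (Or.inl ⟨h1, ⟨h2, hq⟩, h3⟩))
    · exact Or.inr (Or.inl ⟨⟨h1, hp⟩, h2, h3⟩)
  calc volume (rieszSet A B C) ≤ _ := measure_mono hsub
    _ ≤ volume (rieszSet K L M) + (volume (rieszSet (A \ K) B C) +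
        (volume (rieszSet A (B \ L) C) + volume (rieszSet A B (C \ M)))) :=
      (measure_union_le _ _).trans (add_le_add le_rfl ((measure_union_le _ _).trans
        (add_le_add le_rfl (measure_union_le _ _))))
    _ ≤ volume (rieszSet K L M) + (volume (A \ K) * V + (V * volume (B \ L) +
        V * volume (C \ M))) := by
      gcongr
      · exact (measure_rieszSet_le_fst_snd volume _ _ _).trans (by gcongr)
      · exact (measure_rieszSet_le_fst_snd volume _ _ _).trans (by gcongr)
      · exact (measure_rieszSet_le_fst_add volume _ hA (hC.diff hM)).trans (by gcongr)
    _ = _ := by ring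

/-- Triples of subsets of a ball that compete in the Riesz inequality for `(A, B, C)`. -/
structure IsCompetitor (R : ℝ) (A B C A' B' C' : Set (EuclideanSpace ℝ (Fin n))) : Prop where
  measurableSet_fst : MeasurableSet A'
  measurableSet_snd : MeasurableSet B'
  measurableSet_trd : MeasurableSet C'
  subset_fst : A' ⊆ Metric.ball 0 R
  subset_snd : B' ⊆ Metric.ball 0 R
  subset_trd : C' ⊆ Metric.ball 0 R
  volume_fst : volume A' = volume A
  volume_snd : volume B' = volume B
  volume_trd : volume C' = volume C
  le : volume (rieszSet A' B' C') ≥ volume (rieszSet A B C)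

/-- Competitors come arbitrarily close to the centered balls. -/
lemma exists_isCompetitor_sdiff_le {A B C : Set (EuclideanSpace ℝ (Fin n))} {R : ℝ}
    (hA : MeasurableSet A) (hB : MeasurableSet B) (hC : MeasurableSet C)
    (hAR : A ⊆ Metric.ball 0 R) (hBR : B ⊆ Metric.ball 0 R) (hCR : C ⊆ Metric.ball 0 R)
    {ε : ℝ≥0∞} (hε : ε ≠ 0) :
    ∃ A' B' C', IsCompetitor R A B C A' B' C' ∧ volume (A' \ ballRearrange n A) ≤ ε ∧
      volume (B' \ ballRearrange n B) ≤ ε ∧ volume (C' \ ballRearrange n C) ≤ ε := by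
  set K := ballRearrange n A
  set L := ballRearrange n B
  set M := ballRearrange n C
  have hK : MeasurableSet K := measurableSet_ballRearrange A
  have hL : MeasurableSet L := measurableSet_ballRearrange B
  have hM : MeasurableSet M := measurableSet_ballRearrange C
  set V := volume (Metric.ball (0 : EuclideanSpace ℝ (Fin n)) R)
  set W := volume (Metric.ball (0 : EuclideanSpace ℝ (Fin n)) (2 * R))
  have hV : V ≠ ⊤ := measure_ball_lt_top.ne
  have hW : W ≠ ⊤ := measure_ball_lt_top.ne
  let Q : Set ℝ≥0∞ := {x | ∃ A' B' C', IsCompetitor R A B C A' B' C' ∧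
    x = volume (A' ∩ K) + volume (B' ∩ L) + volume (C' ∩ M)}
  have hQV : ∀ x ∈ Q, x ≤ V + V + V := by
    rintro x ⟨A', B', C', h, rfl⟩
    exact add_le_add (add_le_add (measure_mono (inter_subset_left.trans h.subset_fst))
      (measure_mono (inter_subset_left.trans h.subset_snd)))
      (measure_mono (inter_subset_left.trans h.subset_trd))
  have hs : sSup Q ≠ ⊤ := ne_top_of_le_ne_top (by finiteness) (sSup_le hQV)
  set δ := ε * ε / (W + 1)
  have hδ : δ ≠ 0 := by simp [δ, hε, hW]
  obtain ⟨x, ⟨A', B', C', h, rfl⟩, hx⟩ : ∃ x ∈ Q, sSup Q ≤ x + δ := by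
    by_contra! hlt
    have h0 : ∃ x, x ∈ Q := ⟨_, A, B, C, ⟨hA, hB, hC, hAR, hBR, hCR, rfl, rfl, rfl, le_rfl⟩, rfl⟩
    obtain ⟨x, hx⟩ := h0
    have hpos : sSup Q ≠ 0 := (lt_of_le_of_lt (zero_le) (hlt x hx)).ne'
    have hle : sSup Q ≤ sSup Q - δ := sSup_le fun x hx =>
      ENNReal.le_sub_of_add_le_right (by
        have := hlt x hx
        intro h
        simp [h] at this) (hlt x hx).le
    exact absurd hle (not_le.2 (ENNReal.sub_lt_self hs hpos hδ))
  have hgain : ∀ v : EuclideanSpace ℝ (Fin n),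
      volume {x | x ∈ A' \ K ∧ x + v ∈ K \ A'} + volume {x | x ∈ B' \ L ∧ x + v ∈ L \ B'} +
        volume {x | x ∈ C' \ M ∧ x + v ∈ M \ C'} ≤
      (Metric.ball (0 : EuclideanSpace ℝ (Fin n)) (2 * R)).indicator (fun _ => δ) v := by
    intro v
    by_cases hvR : v ∈ Metric.ball (0 : EuclideanSpace ℝ (Fin n)) (2 * R)
    · rw [indicator_of_mem hvR]
      by_cases hv : v = 0
      · have hemp : ∀ X Y : Set (EuclideanSpace ℝ (Fin n)),
            {x | x ∈ X \ Y ∧ x + v ∈ Y \ X} = ∅ := fun X Y => by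
          ext x
          simp only [hv, add_zero, mem_ofPred_eq, mem_empty_iff_false, iff_false]
          exact fun h => h.1.2 h.2.1
        rw [hemp, hemp, hemp]
        simp
      obtain ⟨S, hS, hSr⟩ := exists_steiner hv R
      obtain ⟨a1, a2, a3, a4⟩ := hS A' h.measurableSet_fst h.subset_fst
      obtain ⟨b1, b2, b3, b4⟩ := hS B' h.measurableSet_snd h.subset_snd
      obtain ⟨c1, c2, c3, c4⟩ := hS C' h.measurableSet_trd h.subset_trd
      have hcomp : IsCompetitor R A B C (S A') (S B') (S C') :=
        ⟨a1, b1, c1, a2, b2, c2, a3.trans h.volume_fst, b3.trans h.volume_snd,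
          c3.trans h.volume_trd, h.le.trans (hSr _ _ _ h.measurableSet_fst h.measurableSet_snd
            h.measurableSet_trd h.subset_fst h.subset_snd h.subset_trd)⟩
      have h1 := le_sSup (show _ ∈ Q from ⟨_, _, _, hcomp, rfl⟩)
      have h2 := add_le_add (add_le_add (a4 K hK (isCentered_ballRearrange A))
        (b4 L hL (isCentered_ballRearrange B))) (c4 M hM (isCentered_ballRearrange C))
      have h3 := (h2.trans h1).trans hx
      have hval : volume (A' ∩ K) + volume (B' ∩ L) + volume (C' ∩ M) ≠ ⊤ :=
        ne_top_of_le_ne_top (by finiteness) (hQV _ ⟨A', B', C', h, rfl⟩)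
      refine (ENNReal.add_le_add_iff_left hval).1 (le_trans (le_of_eq ?_) h3)
      ring
    · rw [indicator_of_notMem hvR]
      have hemp : ∀ X Y : Set (EuclideanSpace ℝ (Fin n)), X ⊆ Metric.ball 0 R →
          Y ⊆ Metric.ball 0 R → {x | x ∈ X \ Y ∧ x + v ∈ Y \ X} = ∅ := fun X Y hX hY => by
        ext x
        simp only [mem_ofPred_eq, mem_empty_iff_false, iff_false]
        rintro ⟨h1, h2⟩
        have h1 := hX h1.1
        have h2 := hY h2.1
        rw [mem_ball_zero_iff] at *
        refine hvR ?_
        calc ‖v‖ = ‖(x + v) - x‖ := by rw [add_sub_cancel_left]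
          _ ≤ ‖x + v‖ + ‖x‖ := norm_sub_le _ _
          _ < 2 * R := by linarith
      rw [hemp _ _ h.subset_fst (ballRearrange_subset_ball hAR),
        hemp _ _ h.subset_snd (ballRearrange_subset_ball hBR),
        hemp _ _ h.subset_trd (ballRearrange_subset_ball hCR)]
      simp
  have hint := lintegral_mono hgain (μ := volume)
  have hm1 := measurable_measure_translate (h.measurableSet_fst.diff hK)
    (hK.diff h.measurableSet_fst)
  have hm2 := measurable_measure_translate (h.measurableSet_snd.diff hL)
    (hL.diff h.measurableSet_snd)
  have hm12 : Measurable fun v => volume {x | x ∈ A' \ K ∧ x + v ∈ K \ A'} +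
    volume {x | x ∈ B' \ L ∧ x + v ∈ L \ B'} := hm1.add hm2
  rw [lintegral_indicator measurableSet_ball, setLIntegral_const,
    lintegral_add_left hm12, lintegral_add_left hm1,
    lintegral_measure_translate (h.measurableSet_fst.diff hK) (hK.diff h.measurableSet_fst),
    lintegral_measure_translate (h.measurableSet_snd.diff hL) (hL.diff h.measurableSet_snd),
    lintegral_measure_translate (h.measurableSet_trd.diff hM) (hM.diff h.measurableSet_trd)]
    at hint
  have hfin : ∀ X : Set (EuclideanSpace ℝ (Fin n)), X ⊆ Metric.ball 0 R → volume X ≠ ⊤ :=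
    fun X hX => ne_top_of_le_ne_top hV (measure_mono hX)
  rw [← volume_sdiff_comm h.measurableSet_fst hK
      (h.volume_fst.trans (volume_ballRearrange A).symm) (hfin _ h.subset_fst),
    ← volume_sdiff_comm h.measurableSet_snd hL
      (h.volume_snd.trans (volume_ballRearrange B).symm) (hfin _ h.subset_snd),
    ← volume_sdiff_comm h.measurableSet_trd hM
      (h.volume_trd.trans (volume_ballRearrange C).symm) (hfin _ h.subset_trd)] at hint
  have hδW : δ * W ≤ ε * ε := by
    calc δ * W ≤ δ * (W + 1) := by gcongr; exact le_self_add
      _ = ε * ε := ENNReal.div_mul_cancel (by simp) (ENNReal.add_ne_top.2 ⟨hW, one_ne_top⟩)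
  have hsq : ∀ m : ℝ≥0∞, m * m ≤ δ * W → m ≤ ε := fun m hm => by
    by_contra! hlt
    exact absurd (hm.trans hδW) (not_le.2 (ENNReal.mul_lt_mul hlt hlt))
  refine ⟨A', B', C', h, hsq _ (le_trans ?_ hint), hsq _ (le_trans ?_ hint),
    hsq _ (le_trans ?_ hint)⟩
  · rw [add_assoc]; exact le_self_add
  · exact le_add_self.trans le_self_add
  · exact le_add_self

lemma volume_rieszSet_le_of_subset_ball {A B C : Set (EuclideanSpace ℝ (Fin n))} {R : ℝ}
    (hA : MeasurableSet A) (hB : MeasurableSet B) (hC : MeasurableSet C)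
    (hAR : A ⊆ Metric.ball 0 R) (hBR : B ⊆ Metric.ball 0 R) (hCR : C ⊆ Metric.ball 0 R) :
    volume (rieszSet A B C) ≤
      volume (rieszSet (ballRearrange n A) (ballRearrange n B) (ballRearrange n C)) := by
  refine ENNReal.le_of_forall_pos_le_add fun ε hε _ => ?_
  set V := volume (Metric.ball (0 : EuclideanSpace ℝ (Fin n)) R)
  have hV : V ≠ ⊤ := measure_ball_lt_top.ne
  obtain ⟨A', B', C', h, h1, h2, h3⟩ := exists_isCompetitor_sdiff_le hA hB hC hAR hBR hCR
    (ε := ε / (3 * V + 1)) (by simp [hε.ne', ENNReal.mul_eq_top, hV])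
  refine h.le.trans ((volume_rieszSet_le_add_sdiff (K := ballRearrange n A)
    (L := ballRearrange n B) h.measurableSet_fst h.measurableSet_trd
    (measurableSet_ballRearrange C) (measure_mono h.subset_fst)
    (measure_mono h.subset_snd)).trans ?_)
  gcongr
  calc _ ≤ ((ε : ℝ≥0∞) / (3 * V + 1) + ε / (3 * V + 1) + ε / (3 * V + 1)) * V := by gcongr
    _ = ε / (3 * V + 1) * (3 * V) := by ring
    _ ≤ ε / (3 * V + 1) * (3 * V + 1) := by gcongr; exact le_self_add
    _ = ε := ENNReal.div_mul_cancel (by simp) (by finiteness)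

/-- The Riesz rearrangement inequality for sets. -/
lemma volume_rieszSet_le_ballRearrange {A B C : Set (EuclideanSpace ℝ (Fin n))}
    (hA : MeasurableSet A) (hB : MeasurableSet B) (hC : MeasurableSet C) :
    volume (rieszSet A B C) ≤
      volume (rieszSet (ballRearrange n A) (ballRearrange n B) (ballRearrange n C)) := by
  have hmono : ∀ X : Set (EuclideanSpace ℝ (Fin n)), Monotone fun k : ℕ =>
      X ∩ Metric.ball 0 (k : ℝ) := fun X i j hij =>
    inter_subset_inter_right _ (Metric.ball_subset_ball (Nat.cast_le.2 hij))
  have hU : rieszSet A B C = ⋃ k : ℕ, rieszSet (A ∩ Metric.ball 0 (k : ℝ))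
      (B ∩ Metric.ball 0 (k : ℝ)) (C ∩ Metric.ball 0 (k : ℝ)) := by
    ext ⟨p, q⟩
    rw [mem_iUnion]
    refine ⟨fun ⟨h1, h2, h3⟩ => ?_, fun ⟨k, h1, h2, h3⟩ => ⟨h1.1, h2.1, h3.1⟩⟩
    obtain ⟨k, hk⟩ := exists_nat_gt (max ‖p‖ (max ‖q‖ ‖p + q‖))
    simp only [max_lt_iff] at hk
    refine ⟨k, ⟨h1, ?_⟩, ⟨h2, ?_⟩, h3, ?_⟩ <;> simp [hk]
  rw [hU, Monotone.measure_iUnion fun i j hij =>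
    rieszSet_mono (hmono A hij) (hmono B hij) (hmono C hij)]
  refine iSup_le fun k => (volume_rieszSet_le_of_subset_ball (hA.inter measurableSet_ball)
    (hB.inter measurableSet_ball) (hC.inter measurableSet_ball) inter_subset_right
    inter_subset_right inter_subset_right).trans (measure_mono (rieszSet_mono ?_ ?_ ?_)) <;>
  exact ballRearrange_mono (measure_mono inter_subset_left)

end Riesz

section Layers

lemma volume_restrict_ofReal_lt (a : ℝ≥0∞) :
    volume.restrict (Ioi (0 : ℝ)) {s | ENNReal.ofReal s < a} = a := by
  have hm : MeasurableSet {s : ℝ | ENNReal.ofReal s < a} :=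
    measurableSet_lt ENNReal.measurable_ofReal measurable_const
  rw [Measure.restrict_apply hm]
  by_cases ha : a = ⊤
  · simp [ha]
  · have : {s | ENNReal.ofReal s < a} ∩ Ioi (0 : ℝ) = Ioo 0 a.toReal := by
      ext s
      simp only [mem_inter_iff, mem_ofPred_eq, mem_Ioi, mem_Ioo]
      refine ⟨fun h => ⟨h.2, (ENNReal.ofReal_lt_iff_lt_toReal h.2.le ha).1 h.1⟩,
        fun h => ⟨(ENNReal.ofReal_lt_iff_lt_toReal h.1.le ha).2 h.2, h.1⟩⟩
    rw [this, Real.volume_Ioo, sub_zero, ENNReal.ofReal_toReal ha]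

lemma volume_restrict_le_ofReal_lt {a t : ℝ≥0∞} (ht : t ≠ ⊤) :
    volume.restrict (Ioi (0 : ℝ)) {s | t ≤ ENNReal.ofReal s ∧ ENNReal.ofReal s < a} = a - t := by
  rcases le_total t a with h | h
  · have : {s : ℝ | t ≤ ENNReal.ofReal s ∧ ENNReal.ofReal s < a} =
        {s | ENNReal.ofReal s < a} \ {s | ENNReal.ofReal s < t} := by
      ext s
      simp [and_comm]
    rw [this, measure_sdiff, volume_restrict_ofReal_lt, volume_restrict_ofReal_lt]
    · exact fun s hs => lt_of_lt_of_le hs h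
    · exact (measurableSet_lt ENNReal.measurable_ofReal measurable_const).nullMeasurableSet
    · rwa [volume_restrict_ofReal_lt]
  · have : {s : ℝ | t ≤ ENNReal.ofReal s ∧ ENNReal.ofReal s < a} = ∅ := by
      ext s
      simp only [mem_ofPred_eq, mem_empty_iff_false, iff_false, not_and, not_lt]
      exact fun hs => h.trans hs
    rw [this, measure_empty, tsub_eq_zero_of_le h]

lemma lintegral_indicator_ofReal_lt {α : Type*} (f : α → ℝ≥0∞) (x : α) :
    ∫⁻ t in Ioi (0 : ℝ), {y | ENNReal.ofReal t < f y}.indicator (1 : α → ℝ≥0∞) x = f x := by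
  have : ∀ t : ℝ, {y | ENNReal.ofReal t < f y}.indicator (1 : α → ℝ≥0∞) x =
      {t : ℝ | ENNReal.ofReal t < f x}.indicator (1 : ℝ → ℝ≥0∞) t := fun t => by
    simp [indicator]
  simp_rw [this]
  rw [lintegral_indicator_one (measurableSet_lt ENNReal.measurable_ofReal measurable_const),
    volume_restrict_ofReal_lt]

variable {α : Type*} [MeasurableSpace α]

lemma measurableSet_superlevel {f : α → ℝ≥0∞} (hf : Measurable f) :
    MeasurableSet {p : ℝ × α | p.2 ∈ {y | ENNReal.ofReal p.1 < f y}} :=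
  measurableSet_lt (ENNReal.measurable_ofReal.comp measurable_fst) (hf.comp measurable_snd)

lemma measurable_layer {S : ℝ → Set α} (hS : MeasurableSet {p : ℝ × α | p.2 ∈ S p.1}) :
    Measurable fun x => ∫⁻ t in Ioi (0 : ℝ), (S t).indicator (1 : α → ℝ≥0∞) x := by
  refine Measurable.lintegral_prod_right' (f := fun p : α × ℝ =>
    (S p.2).indicator (1 : α → ℝ≥0∞) p.1) ?_
  exact (measurable_one.indicator hS).comp measurable_swap

lemma lintegral_layer_mul {Ω : Type*} [MeasurableSpace Ω] {μ : Measure Ω} [SFinite μ]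
    {S : ℝ → Set α} (hS : MeasurableSet {p : ℝ × α | p.2 ∈ S p.1}) {π : Ω → α}
    (hπ : Measurable π) {k : Ω → ℝ≥0∞} (hk : Measurable k) :
    ∫⁻ p, (∫⁻ t in Ioi (0 : ℝ), (S t).indicator (1 : α → ℝ≥0∞) (π p)) * k p ∂μ =
      ∫⁻ t in Ioi (0 : ℝ), ∫⁻ p in π ⁻¹' S t, k p ∂μ := by
  have hSt : ∀ t, MeasurableSet (S t) := fun t => measurable_prodMk_left hS
  have h1 : Measurable fun q : ℝ × α => (S q.1).indicator (1 : α → ℝ≥0∞) q.2 :=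
    measurable_one.indicator hS
  have h2 : Measurable fun q : Ω × ℝ => (S q.2).indicator (1 : α → ℝ≥0∞) (π q.1) * k q.1 :=
    (h1.comp (measurable_snd.prodMk (hπ.comp measurable_fst))).mul (hk.comp measurable_fst)
  calc _ = ∫⁻ p, ∫⁻ t in Ioi (0 : ℝ), (S t).indicator (1 : α → ℝ≥0∞) (π p) * k p ∂volume ∂μ :=
        lintegral_congr fun p => (lintegral_mul_const _
          (h1.comp (measurable_id.prodMk measurable_const))).symm
    _ = _ := lintegral_lintegral_swap h2.aemeasurable
    _ = _ := lintegral_congr fun t => by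
        rw [← lintegral_indicator (hπ (hSt t))]
        refine lintegral_congr fun p => ?_
        by_cases hp : π p ∈ S t <;> simp [hp]

lemma lintegral_layer {μ : Measure α} [SFinite μ]
    {S : ℝ → Set α} (hS : MeasurableSet {p : ℝ × α | p.2 ∈ S p.1}) :
    ∫⁻ x, ∫⁻ t in Ioi (0 : ℝ), (S t).indicator (1 : α → ℝ≥0∞) x ∂volume ∂μ =
      ∫⁻ t in Ioi (0 : ℝ), μ (S t) := by
  have := lintegral_layer_mul (μ := μ) hS measurable_id (k := fun _ => 1) measurable_const
  simpa using this

lemma lintegral_eq_superlevel {μ : Measure α} [SFinite μ] {f : α → ℝ≥0∞} (hf : Measurable f) :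
    ∫⁻ x, f x ∂μ = ∫⁻ t in Ioi (0 : ℝ), μ {y | ENNReal.ofReal t < f y} := by
  rw [← lintegral_layer (measurableSet_superlevel hf)]
  simp_rw [lintegral_indicator_ofReal_lt]

lemma lintegral_sub_eq_superlevel {μ : Measure α} [SFinite μ] {f : α → ℝ≥0∞}
    (hf : Measurable f) {t : ℝ≥0∞} (ht : t ≠ ⊤) :
    ∫⁻ x, (f x - t) ∂μ = ∫⁻ s in Ioi (0 : ℝ),
      {s : ℝ | t ≤ ENNReal.ofReal s}.indicator (fun s => μ {y | ENNReal.ofReal s < f y}) s := by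
  have hS : MeasurableSet {p : ℝ × α | p.2 ∈ {y | t ≤ ENNReal.ofReal p.1 ∧
      ENNReal.ofReal p.1 < f y}} :=
    (measurableSet_le measurable_const (ENNReal.measurable_ofReal.comp measurable_fst)).inter
      (measurableSet_superlevel hf)
  have h := lintegral_layer (μ := μ)
    (S := fun s => {y | t ≤ ENNReal.ofReal s ∧ ENNReal.ofReal s < f y}) hS
  have h2 : ∀ x, ∫⁻ s in Ioi (0 : ℝ), {y | t ≤ ENNReal.ofReal s ∧
      ENNReal.ofReal s < f y}.indicator (1 : α → ℝ≥0∞) x = f x - t := fun x => by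
    have : ∀ s : ℝ, {y | t ≤ ENNReal.ofReal s ∧ ENNReal.ofReal s < f y}.indicator
        (1 : α → ℝ≥0∞) x = {s : ℝ | t ≤ ENNReal.ofReal s ∧
          ENNReal.ofReal s < f x}.indicator (1 : ℝ → ℝ≥0∞) s := fun s => by
      simp [indicator]
    simp_rw [this]
    rw [lintegral_indicator_one, volume_restrict_le_ofReal_lt ht]
    exact (measurableSet_le measurable_const ENNReal.measurable_ofReal).inter
      (measurableSet_lt ENNReal.measurable_ofReal measurable_const)
  simp_rw [h2] at h
  rw [h]
  refine lintegral_congr fun s => ?_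
  by_cases hs : t ≤ ENNReal.ofReal s <;> simp [hs]

end Layers

section Radial

variable {n : ℕ}

/-- Functions that decrease with the norm of their argument. -/
def RadiallyAntitone {E : Type*} [Norm E] (f : E → ℝ≥0∞) : Prop :=
  ∀ ⦃x y : E⦄, ‖y‖ ≤ ‖x‖ → f x ≤ f y

lemma RadiallyAntitone.isCentered {E : Type*} [Norm E] {f : E → ℝ≥0∞} (hf : RadiallyAntitone f)
    (t : ℝ≥0∞) : IsCentered {x | t < f x} :=
  fun _ _ h hx => lt_of_lt_of_le hx (hf h)

lemma RadiallyAntitone.eq {E : Type*} [Norm E] {f : E → ℝ≥0∞} (hf : RadiallyAntitone f)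
    {x y : E} (h : ‖x‖ = ‖y‖) : f x = f y :=
  le_antisymm (hf h.ge) (hf h.le)

lemma IsCentered.radiallyAntitone {E : Type*} [Norm E] {K : Set E} (hK : IsCentered K) :
    RadiallyAntitone (K.indicator (1 : E → ℝ≥0∞)) := fun x y h => by
  by_cases hx : x ∈ K
  · simp [hx, hK h hx]
  · simp [hx]

lemma IsCentered.measure_inter {E : Type*} [Norm E] [MeasurableSpace E] (μ : Measure E)
    {K L : Set E} (hK : IsCentered K) (hL : IsCentered L) : μ (K ∩ L) = min (μ K) (μ L) := by
  have : K ⊆ L ∨ L ⊆ K := by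
    by_contra! h
    obtain ⟨x, hxK, hxL⟩ := not_subset.1 h.1
    obtain ⟨y, hyL, hyK⟩ := not_subset.1 h.2
    rcases le_total ‖x‖ ‖y‖ with hxy | hxy
    · exact hxL (hL hxy hyL)
    · exact hyK (hK hxy hxK)
  rcases this with h | h
  · rw [inter_eq_left.2 h, min_eq_left (measure_mono h)]
  · rw [inter_eq_right.2 h, min_eq_right (measure_mono h)]

lemma measurableSet_ballRearrange_superlevel (f : EuclideanSpace ℝ (Fin n) → ℝ≥0∞) :
    MeasurableSet {p : ℝ × EuclideanSpace ℝ (Fin n) |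
      p.2 ∈ ballRearrange n {y | ENNReal.ofReal p.1 < f y}} := by
  have : Antitone fun t : ℝ => volume {y | ENNReal.ofReal t < f y} := fun s t h =>
    measure_mono fun y (hy : _ < _) => lt_of_le_of_lt (ENNReal.ofReal_le_ofReal h) hy
  exact measurableSet_lt (measurable_volume_ball_norm.comp measurable_snd)
    (this.measurable.comp measurable_fst)

lemma measurable_symmRearr (f : EuclideanSpace ℝ (Fin n) → ℝ≥0∞) :
    Measurable (symmRearr n f) :=
  measurable_layer (measurableSet_ballRearrange_superlevel f)

lemma radiallyAntitone_symmRearr (f : EuclideanSpace ℝ (Fin n) → ℝ≥0∞) :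
    RadiallyAntitone (symmRearr n f) := fun _ _ h =>
  lintegral_mono fun _ => (isCentered_ballRearrange _).radiallyAntitone h

lemma lintegral_symmRearr {f : EuclideanSpace ℝ (Fin n) → ℝ≥0∞} (hf : Measurable f) :
    ∫⁻ x, symmRearr n f x = ∫⁻ x, f x := by
  rw [lintegral_eq_superlevel hf]
  refine (lintegral_layer (measurableSet_ballRearrange_superlevel f)).trans ?_
  simp_rw [volume_ballRearrange]

lemma setLIntegral_le_symmRearr {f : EuclideanSpace ℝ (Fin n) → ℝ≥0∞} (hf : Measurable f)
    (C : Set (EuclideanSpace ℝ (Fin n))) :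
    ∫⁻ x in C, f x ≤ ∫⁻ x in ballRearrange n C, symmRearr n f x := by
  rw [lintegral_eq_superlevel hf]
  refine le_trans (lintegral_mono fun t => ?_)
    (lintegral_layer (measurableSet_ballRearrange_superlevel f)).ge
  rw [Measure.restrict_apply (measurableSet_ballRearrange _),
    (isCentered_ballRearrange _).measure_inter _ (isCentered_ballRearrange _),
    volume_ballRearrange, volume_ballRearrange,
    Measure.restrict_apply (measurableSet_lt measurable_const hf)]
  exact le_min (measure_mono inter_subset_left) (measure_mono inter_subset_right)

end Radial

section Convolution

variable {n : ℕ}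

lemma measurable_conv2 {f g : EuclideanSpace ℝ (Fin n) → ℝ≥0∞} (hf : Measurable f)
    (hg : Measurable g) : Measurable (conv2 n f g) :=
  Measurable.lintegral_prod_right' (f := fun p : EuclideanSpace ℝ (Fin n) ×
    EuclideanSpace ℝ (Fin n) => f p.2 * g (p.1 - p.2))
    ((hf.comp measurable_snd).mul (hg.comp (measurable_fst.sub measurable_snd)))

lemma lintegral_conv2_mul {f g w : EuclideanSpace ℝ (Fin n) → ℝ≥0∞} (hf : Measurable f)
    (hg : Measurable g) (hw : Measurable w) :
    ∫⁻ x, conv2 n f g x * w x = ∫⁻ y, ∫⁻ z, f y * (g z * w (y + z)) := by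
  have hm : Measurable fun p : EuclideanSpace ℝ (Fin n) × EuclideanSpace ℝ (Fin n) =>
      f p.2 * g (p.1 - p.2) :=
    (hf.comp measurable_snd).mul (hg.comp (measurable_fst.sub measurable_snd))
  calc ∫⁻ x, conv2 n f g x * w x = ∫⁻ x, ∫⁻ y, f y * g (x - y) * w x :=
        lintegral_congr fun x => (lintegral_mul_const _
          (hm.comp (measurable_const.prodMk measurable_id))).symm
    _ = ∫⁻ y, ∫⁻ x, f y * g (x - y) * w x := lintegral_lintegral_swap
        (hm.mul (hw.comp measurable_fst)).aemeasurable
    _ = _ := lintegral_congr fun y => by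
        rw [← lintegral_add_left_eq_self _ y]
        refine lintegral_congr fun z => ?_
        rw [add_sub_cancel_left, mul_assoc]

lemma lintegral_conv2 {f g : EuclideanSpace ℝ (Fin n) → ℝ≥0∞} (hf : Measurable f)
    (hg : Measurable g) : ∫⁻ x, conv2 n f g x = (∫⁻ x, f x) * ∫⁻ x, g x := by
  have h := lintegral_conv2_mul hf hg (w := fun _ => 1) measurable_const
  simp only [mul_one] at h
  rw [h, ← lintegral_mul_const _ hf]
  exact lintegral_congr fun y => lintegral_const_mul _ hg

lemma lintegral_conv2_mul_eq {f g w : EuclideanSpace ℝ (Fin n) → ℝ≥0∞} (hf : Measurable f)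
    (hg : Measurable g) (hw : Measurable w) (hfe : ∀ y, f (-y) = f y) :
    ∫⁻ x, conv2 n f g x * w x = ∫⁻ z, g z * conv2 n f w z := by
  rw [lintegral_conv2_mul hf hg hw, lintegral_lintegral_swap]
  · refine lintegral_congr fun z => ?_
    have hm : Measurable fun y => f y * w (z - y) :=
      hf.mul (hw.comp (measurable_const.sub measurable_id))
    rw [conv2, ← lintegral_const_mul _ hm, ← lintegral_neg_eq_self]
    refine lintegral_congr fun y => ?_
    rw [hfe, ← sub_eq_neg_add]
    ring
  · exact ((hf.comp measurable_fst).mul ((hg.comp measurable_snd).mul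
      (hw.comp (measurable_fst.add measurable_snd)))).aemeasurable

lemma setLIntegral_conv2_layer {S S' : ℝ → Set (EuclideanSpace ℝ (Fin n))}
    {C : Set (EuclideanSpace ℝ (Fin n))}
    (hS : MeasurableSet {p : ℝ × EuclideanSpace ℝ (Fin n) | p.2 ∈ S p.1})
    (hS' : MeasurableSet {p : ℝ × EuclideanSpace ℝ (Fin n) | p.2 ∈ S' p.1})
    (hC : MeasurableSet C) :
    ∫⁻ x in C, conv2 n (fun x => ∫⁻ t in Ioi (0 : ℝ), (S t).indicator 1 x)
      (fun x => ∫⁻ t in Ioi (0 : ℝ), (S' t).indicator 1 x) x =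
      ∫⁻ t in Ioi (0 : ℝ), ∫⁻ s in Ioi (0 : ℝ), volume (rieszSet (S t) (S' s) C) := by
  have hSt : ∀ t, MeasurableSet (S t) := fun t => measurable_prodMk_left hS
  have hSt' : ∀ t, MeasurableSet (S' t) := fun t => measurable_prodMk_left hS'
  set f := fun x => ∫⁻ t in Ioi (0 : ℝ),
    (S t).indicator (1 : EuclideanSpace ℝ (Fin n) → ℝ≥0∞) x with hf
  set g := fun x => ∫⁻ t in Ioi (0 : ℝ),
    (S' t).indicator (1 : EuclideanSpace ℝ (Fin n) → ℝ≥0∞) x with hg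
  have hfm : Measurable f := measurable_layer hS
  have hgm : Measurable g := measurable_layer hS'
  have hCm : Measurable (C.indicator (1 : EuclideanSpace ℝ (Fin n) → ℝ≥0∞)) :=
    measurable_one.indicator hC
  have hadd : Measurable fun p : EuclideanSpace ℝ (Fin n) × EuclideanSpace ℝ (Fin n) =>
    p.1 + p.2 := measurable_fst.add measurable_snd
  calc ∫⁻ x in C, conv2 n f g x = ∫⁻ x, conv2 n f g x * C.indicator 1 x := by
        rw [← lintegral_indicator hC]
        refine lintegral_congr fun x => ?_
        by_cases hx : x ∈ C <;> simp [hx]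
    _ = ∫⁻ p : EuclideanSpace ℝ (Fin n) × EuclideanSpace ℝ (Fin n),
          f p.1 * (g p.2 * C.indicator 1 (p.1 + p.2)) ∂(volume.prod volume) := by
        rw [lintegral_conv2_mul hfm hgm hCm, lintegral_prod]
        exact ((hfm.comp measurable_fst).mul ((hgm.comp measurable_snd).mul
          (hCm.comp hadd))).aemeasurable
    _ = ∫⁻ t in Ioi (0 : ℝ), ∫⁻ p in Prod.fst ⁻¹' S t,
          g p.2 * C.indicator 1 (p.1 + p.2) ∂(volume.prod volume) :=
        lintegral_layer_mul hS measurable_fst ((hgm.comp measurable_snd).mul (hCm.comp hadd))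
    _ = ∫⁻ t in Ioi (0 : ℝ), ∫⁻ s in Ioi (0 : ℝ), ∫⁻ p in Prod.snd ⁻¹' S' s,
          C.indicator 1 (p.1 + p.2) ∂((volume.prod volume).restrict (Prod.fst ⁻¹' S t)) :=
        lintegral_congr fun t => lintegral_layer_mul hS' measurable_snd (hCm.comp hadd)
    _ = _ := by
        refine lintegral_congr fun t => lintegral_congr fun s => ?_
        have : ∀ p : EuclideanSpace ℝ (Fin n) × EuclideanSpace ℝ (Fin n),
            C.indicator (1 : EuclideanSpace ℝ (Fin n) → ℝ≥0∞) (p.1 + p.2) =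
              ((fun p : EuclideanSpace ℝ (Fin n) × EuclideanSpace ℝ (Fin n) =>
                p.1 + p.2) ⁻¹' C).indicator 1 p := fun p => rfl
        simp_rw [this]
        rw [lintegral_indicator_one (hadd hC), Measure.restrict_apply (hadd hC),
          Measure.restrict_apply ((hadd hC).inter (measurable_snd (hSt' s)))]
        congr 1
        ext p
        simp only [rieszSet, mem_inter_iff, mem_preimage, mem_ofPred_eq]
        tauto

lemma setLIntegral_conv2_le_symmRearr {f g : EuclideanSpace ℝ (Fin n) → ℝ≥0∞}
    {C : Set (EuclideanSpace ℝ (Fin n))} (hf : Measurable f) (hg : Measurable g)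
    (hC : MeasurableSet C) :
    ∫⁻ x in C, conv2 n f g x ≤
      ∫⁻ x in ballRearrange n C, conv2 n (symmRearr n f) (symmRearr n g) x := by
  have h1 := setLIntegral_conv2_layer (S := fun t => {y | ENNReal.ofReal t < f y})
    (S' := fun t => {y | ENNReal.ofReal t < g y}) (measurableSet_superlevel hf)
    (measurableSet_superlevel hg) hC
  simp_rw [lintegral_indicator_ofReal_lt] at h1
  refine h1.le.trans (le_trans ?_ (setLIntegral_conv2_layer
    (measurableSet_ballRearrange_superlevel f) (measurableSet_ballRearrange_superlevel g)
    (measurableSet_ballRearrange C)).ge)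
  exact lintegral_mono fun t => lintegral_mono fun s =>
    volume_rieszSet_le_ballRearrange (measurableSet_lt measurable_const hf)
      (measurableSet_lt measurable_const hg) hC

/-- The reflection exchanging two points moves every point on the side of the one closer to the
origin away from the origin, and conversely. -/
lemma exists_reflection {x x' : EuclideanSpace ℝ (Fin n)} (h : ‖x‖ ≤ ‖x'‖) :
    ∃ σ : EuclideanSpace ℝ (Fin n) → EuclideanSpace ℝ (Fin n),
      MeasurePreserving σ volume volume ∧ (∀ y, ‖x - σ y‖ = ‖x' - y‖) ∧
      (∀ y, ‖x' - σ y‖ = ‖x - y‖) ∧ (∀ y, ‖x - y‖ ≤ ‖x' - y‖ → ‖y‖ ≤ ‖σ y‖) ∧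
      ∀ y, ‖x' - y‖ ≤ ‖x - y‖ → ‖σ y‖ ≤ ‖y‖ := by
  by_cases hxx : x = x'
  · subst hxx
    exact ⟨id, MeasurePreserving.id _, by simp, by simp, by simp, by simp⟩
  set d := x' - x with hd
  have hdn : ‖d‖ ≠ 0 := norm_ne_zero_iff.2 (sub_ne_zero.2 (Ne.symm hxx))
  have hd0 : 0 < ‖d‖ ^ 2 := by positivity
  set ρ := (ℝ ∙ d)ᗮ.reflection with hρ
  have hρd : ρ d = -d := Submodule.reflection_orthogonalComplement_singleton_eq_neg d
  have hρx : ρ x' = ρ x - d := by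
    have : x' = x + d := by rw [hd]; abel
    rw [this, map_add, hρd, sub_eq_add_neg]
  set c := x' - ρ x with hc
  have e1 : ∀ y, x' - (ρ y + c) = ρ (x - y) := fun y => by rw [map_sub, hc]; abel
  have e2 : ∀ y, x - (ρ y + c) = ρ (x' - y) := fun y => by rw [map_sub, hρx, hc, hd]; abel
  have hform : ∀ y, ρ y = y - (2 * (inner ℝ d y / ‖d‖ ^ 2)) • d := fun y => by
    rw [hρ, Submodule.reflection_orthogonal_apply, Submodule.reflection_singleton_apply]
    module
  have key : ∀ y, ‖ρ y + c‖ ^ 2 - ‖y‖ ^ 2 =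
      (‖x' - y‖ ^ 2 - ‖x - y‖ ^ 2) * ((‖x'‖ ^ 2 - ‖x‖ ^ 2) / ‖d‖ ^ 2) := fun y => by
    have hx' : x' = x + d := by rw [hd]; abel
    have n1 : ‖x'‖ ^ 2 = ‖x‖ ^ 2 + 2 * inner ℝ d x + ‖d‖ ^ 2 := by
      rw [hx', norm_add_sq_real, real_inner_comm]
    have n2 : ‖x' - y‖ ^ 2 = ‖x - y‖ ^ 2 + 2 * (inner ℝ d x - inner ℝ d y) + ‖d‖ ^ 2 := by
      rw [hx', add_sub_right_comm, norm_add_sq_real, real_inner_comm, inner_sub_right]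
    have n3 : ρ y + c = y + (1 - 2 * ((inner ℝ d y - inner ℝ d x) / ‖d‖ ^ 2)) • d := by
      rw [hc, hform, hform, hx']
      module
    rw [n3, norm_add_sq_real, norm_smul, mul_pow, Real.norm_eq_abs, sq_abs, inner_smul_right,
      real_inner_comm d y, n1, n2]
    field_simp
    ring
  have hfac : 0 ≤ (‖x'‖ ^ 2 - ‖x‖ ^ 2) / ‖d‖ ^ 2 :=
    div_nonneg (sub_nonneg.2 (pow_le_pow_left₀ (norm_nonneg x) h 2)) hd0.le
  refine ⟨fun y => ρ y + c, (measurePreserving_add_right volume c).comp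
    ρ.measurePreserving, fun y => ?_, fun y => ?_, fun y hy => ?_, fun y hy => ?_⟩
  · rw [e2, LinearIsometryEquiv.norm_map]
  · rw [e1, LinearIsometryEquiv.norm_map]
  · have h2 := pow_le_pow_left₀ (norm_nonneg _) hy 2
    have := mul_nonneg (sub_nonneg.2 h2) hfac
    exact (pow_le_pow_iff_left₀ (norm_nonneg _) (norm_nonneg _) two_ne_zero).1
      (by linarith [key y])
  · have h2 := pow_le_pow_left₀ (norm_nonneg _) hy 2
    have := mul_nonneg (sub_nonneg.2 h2) hfac
    exact (pow_le_pow_iff_left₀ (norm_nonneg _) (norm_nonneg _) two_ne_zero).1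
      (by linarith [key y])

lemma mul_add_mul_le_of_le {a b c d : ℝ≥0∞} (hab : a ≤ b) (hcd : c ≤ d) :
    a * d + b * c ≤ a * c + b * d := by
  obtain ⟨e, rfl⟩ := exists_add_of_le hab
  obtain ⟨k, rfl⟩ := exists_add_of_le hcd
  calc a * (c + k) + (a + e) * c ≤ a * (c + k) + (a + e) * c + e * k := le_self_add
    _ = _ := by ring

lemma radiallyAntitone_conv2 {f g : EuclideanSpace ℝ (Fin n) → ℝ≥0∞} (hf : Measurable f)
    (hg : Measurable g) (hfr : RadiallyAntitone f) (hgr : RadiallyAntitone g) :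
    RadiallyAntitone (conv2 n f g) := by
  intro x' x h
  obtain ⟨σ, hσ, h1, h2, h3, h4⟩ := exists_reflection h
  have hm : ∀ z, Measurable fun y => f y * g (z - y) := fun z =>
    hf.mul (hg.comp (measurable_const.sub measurable_id))
  have hc : ∀ z, conv2 n f g z = ∫⁻ y, f (σ y) * g (z - σ y) := fun z =>
    (hσ.lintegral_comp (hm z)).symm
  have hadd : ∀ z z', conv2 n f g z + conv2 n f g z' =
      ∫⁻ y, (f y * g (z - y) + f (σ y) * g (z' - σ y)) := fun z z' => by
    rw [lintegral_add_left (hm z), ← hc]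
    rfl
  have hle : conv2 n f g x' + conv2 n f g x' ≤
      conv2 n f g x + conv2 n f g x := by
    rw [hadd, hadd]
    refine lintegral_mono fun y => ?_
    simp only
    rw [hgr.eq (h1 y), hgr.eq (h2 y)]
    rcases le_total ‖x - y‖ ‖x' - y‖ with hy | hy
    · have := mul_add_mul_le_of_le (hfr (h3 y hy)) (hgr hy)
      rw [add_comm] at this
      exact this.trans_eq (add_comm _ _)
    · exact mul_add_mul_le_of_le (hfr (h4 y hy)) (hgr hy)
  rw [← two_mul, ← two_mul] at hle
  exact (ENNReal.mul_le_mul_iff_right two_ne_zero ofNat_ne_top).1 hle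

end Convolution

section Domination

variable {n : ℕ}

/-- `G` is a radially decreasing density whose tail integrals `∫ (G - t)₊` exceed those of `F`. -/
structure TailDominates (F G : EuclideanSpace ℝ (Fin n) → ℝ≥0∞) : Prop where
  isDensity_left : IsDensity n F
  isDensity_right : IsDensity n G
  radial : RadiallyAntitone G
  tail_le : ∀ t : ℝ≥0∞, ∫⁻ x, (F x - t) ≤ ∫⁻ x, (G x - t)

lemma TailDominates.of_setLIntegral_le {F G : EuclideanSpace ℝ (Fin n) → ℝ≥0∞}
    (hF : IsDensity n F) (hG : IsDensity n G) (hGr : RadiallyAntitone G)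
    (h : ∀ C, MeasurableSet C → ∫⁻ x in C, F x ≤ ∫⁻ x in ballRearrange n C, G x) :
    TailDominates F G := by
  refine ⟨hF, hG, hGr, fun t => ?_⟩
  by_cases ht : t = ⊤
  · simp [ht]
  by_cases ht0 : t = 0
  · simp [ht0, hF.2, hG.2]
  set C := {x | t < F x} with hC
  have hCm : MeasurableSet C := measurableSet_lt measurable_const hF.1
  have hCle : t * volume C ≤ 1 := by
    rw [← hF.2]
    exact (mul_le_mul_right (measure_mono fun x (hx : t < F x) => hx.le) t).trans
      (mul_meas_ge_le_lintegral hF.1 t)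
  have hfin : t * volume C ≠ ⊤ := ne_top_of_le_ne_top one_ne_top hCle
  have h1 : ∫⁻ x in C, F x = t * volume C + ∫⁻ x, (F x - t) := by
    have : ∫⁻ x, (F x - t) = ∫⁻ x in C, (F x - t) := by
      rw [← lintegral_indicator hCm]
      refine lintegral_congr fun x => ?_
      by_cases hx : x ∈ C
      · rw [indicator_of_mem hx]
      · rw [indicator_of_notMem hx, tsub_eq_zero_of_le (not_lt.1 hx)]
    rw [this, ← setLIntegral_const, ← lintegral_add_left measurable_const]
    exact setLIntegral_congr_fun hCm fun x hx =>
      (add_tsub_cancel_of_le (le_of_lt (show t < F x from hx))).symm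
  have h2 : ∫⁻ x in ballRearrange n C, G x ≤ t * volume C + ∫⁻ x, (G x - t) := by
    calc ∫⁻ x in ballRearrange n C, G x
        ≤ ∫⁻ x in ballRearrange n C, (t + (G x - t)) := lintegral_mono fun x => le_add_tsub
      _ = t * volume C + ∫⁻ x in ballRearrange n C, (G x - t) := by
          rw [lintegral_add_left measurable_const, setLIntegral_const, volume_ballRearrange]
      _ ≤ _ := add_le_add le_rfl (setLIntegral_le_lintegral _ _)
  exact (ENNReal.add_le_add_iff_left hfin).1 (h1.ge.trans ((h C hCm).trans h2))

lemma TailDominates.setLIntegral_symmRearr_le {F G : EuclideanSpace ℝ (Fin n) → ℝ≥0∞}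
    (h : TailDominates F G) {D : Set (EuclideanSpace ℝ (Fin n))} (hD : MeasurableSet D)
    (hDc : IsCentered D) : ∫⁻ x in D, symmRearr n F x ≤ ∫⁻ x in D, G x := by
  by_cases hD0 : volume D = 0
  · rw [setLIntegral_measure_zero _ _ hD0]
    exact zero_le
  set t := ⨆ x ∈ Dᶜ, G x with ht
  have hout : ∀ x, x ∉ D → G x ≤ t := fun x hx => le_iSup₂ (f := fun x (_ : x ∈ Dᶜ) => G x) x hx
  have hin : ∀ x ∈ D, t ≤ G x := fun x hx => iSup₂_le fun y hy => h.radial <| by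
    by_contra! hxy
    exact hy (hDc hxy.le hx)
  have hsplit : t * volume D + ∫⁻ x, (G x - t) ≤ ∫⁻ x in D, G x := by
    have : ∫⁻ x, (G x - t) = ∫⁻ x in D, (G x - t) := by
      rw [← lintegral_indicator hD]
      refine lintegral_congr fun x => ?_
      by_cases hx : x ∈ D
      · rw [indicator_of_mem hx]
      · rw [indicator_of_notMem hx, tsub_eq_zero_of_le (hout x hx)]
    rw [this, ← setLIntegral_const, ← lintegral_add_left measurable_const]
    exact (setLIntegral_congr_fun hD fun x hx => add_tsub_cancel_of_le (hin x hx)).le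
  have htt : t ≠ ⊤ := fun htop => by
    have h1 := le_self_add.trans (hsplit.trans (setLIntegral_le_lintegral _ _))
    rw [htop, ENNReal.top_mul hD0, h.isDensity_right.2] at h1
    simp at h1
  refine le_trans ?_ ((add_le_add le_rfl (h.tail_le t)).trans hsplit)
  have hconst : t * volume D = ∫⁻ s in Ioi (0 : ℝ),
      {s : ℝ | ENNReal.ofReal s < t}.indicator (fun _ => volume D) s := by
    have hm : MeasurableSet {s : ℝ | ENNReal.ofReal s < t} :=
      measurableSet_lt ENNReal.measurable_ofReal measurable_const
    rw [lintegral_indicator_const hm, volume_restrict_ofReal_lt, mul_comm]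
  rw [hconst, lintegral_sub_eq_superlevel h.isDensity_left.1 htt, ← lintegral_add_left
    (measurable_const.indicator (measurableSet_lt ENNReal.measurable_ofReal measurable_const))]
  refine (lintegral_layer (measurableSet_ballRearrange_superlevel F)).le.trans
    (lintegral_mono fun s => ?_)
  rw [Measure.restrict_apply (measurableSet_ballRearrange _)]
  by_cases hs : ENNReal.ofReal s < t
  · simp only [indicator, mem_ofPred_eq, hs, if_true, not_le.2 hs, if_false, add_zero]
    exact measure_mono inter_subset_right
  · simp only [indicator, mem_ofPred_eq, hs, if_true, not_lt.1 hs, if_false, zero_add]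
    rw [← volume_ballRearrange {y | ENNReal.ofReal s < F y}]
    exact measure_mono inter_subset_left

lemma lintegral_mul_le_of_setLIntegral_le {F G w : EuclideanSpace ℝ (Fin n) → ℝ≥0∞}
    (hF : Measurable F) (hG : Measurable G) (hw : Measurable w) (hwr : RadiallyAntitone w)
    (h : ∀ D, MeasurableSet D → IsCentered D → ∫⁻ x in D, F x ≤ ∫⁻ x in D, G x) :
    ∫⁻ x, F x * w x ≤ ∫⁻ x, G x * w x := by
  have hl : ∀ {k : EuclideanSpace ℝ (Fin n) → ℝ≥0∞}, Measurable k → ∫⁻ x, k x * w x =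
      ∫⁻ t in Ioi (0 : ℝ), ∫⁻ x in {x | ENNReal.ofReal t < w x}, k x := fun {k} hk => by
    have := lintegral_layer_mul (μ := volume) (S := fun t => {x | ENNReal.ofReal t < w x})
      (measurableSet_superlevel hw) measurable_id hk
    simp_rw [lintegral_indicator_ofReal_lt] at this
    simpa [mul_comm] using this
  rw [hl hF, hl hG]
  exact lintegral_mono fun t => h _ (measurableSet_lt measurable_const hw) (hwr.isCentered _)

lemma isDensity_symmRearr {f : EuclideanSpace ℝ (Fin n) → ℝ≥0∞} (hf : IsDensity n f) :
    IsDensity n (symmRearr n f) :=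
  ⟨measurable_symmRearr f, (lintegral_symmRearr hf.1).trans hf.2⟩

lemma isDensity_conv2 {f g : EuclideanSpace ℝ (Fin n) → ℝ≥0∞} (hf : IsDensity n f)
    (hg : IsDensity n g) : IsDensity n (conv2 n f g) :=
  ⟨measurable_conv2 hf.1 hg.1, by rw [lintegral_conv2 hf.1 hg.1, hf.2, hg.2, one_mul]⟩

lemma tailDominates_conv2 {f F G : EuclideanSpace ℝ (Fin n) → ℝ≥0∞} (hf : IsDensity n f)
    (h : TailDominates F G) :
    TailDominates (conv2 n f F) (conv2 n (symmRearr n f) G) := by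
  have hfs := measurable_symmRearr f
  have hfr := radiallyAntitone_symmRearr f
  refine .of_setLIntegral_le (isDensity_conv2 hf h.isDensity_left)
    (isDensity_conv2 (isDensity_symmRearr hf) h.isDensity_right)
    (radiallyAntitone_conv2 hfs h.isDensity_right.1 hfr h.radial) fun C hC => ?_
  set K := ballRearrange n C
  have hK : MeasurableSet K := measurableSet_ballRearrange C
  have hKm : Measurable (K.indicator (1 : EuclideanSpace ℝ (Fin n) → ℝ≥0∞)) :=
    measurable_one.indicator hK
  have hset : ∀ {g : EuclideanSpace ℝ (Fin n) → ℝ≥0∞}, Measurable g →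
      ∫⁻ x in K, conv2 n (symmRearr n f) g x =
        ∫⁻ z, g z * conv2 n (symmRearr n f) (K.indicator 1) z := fun {g} hg => by
    rw [← lintegral_conv2_mul_eq hfs hg hKm fun y => hfr.eq (norm_neg y),
      ← lintegral_indicator hK]
    refine lintegral_congr fun x => ?_
    by_cases hx : x ∈ K <;> simp [hx]
  refine (setLIntegral_conv2_le_symmRearr hf.1 h.isDensity_left.1 hC).trans ?_
  rw [hset (measurable_symmRearr F), hset h.isDensity_right.1]
  exact lintegral_mul_le_of_setLIntegral_le (measurable_symmRearr F) h.isDensity_right.1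
    (measurable_conv2 hfs hKm)
    (radiallyAntitone_conv2 hfs hKm hfr (isCentered_ballRearrange C).radiallyAntitone)
    fun D hD hDc => h.setLIntegral_symmRearr_le hD hDc

lemma tailDominates_convList {l : List (EuclideanSpace ℝ (Fin n) → ℝ≥0∞)} (hl : l ≠ [])
    (hd : ∀ f ∈ l, IsDensity n f) :
    TailDominates (convList n l) (convList n (l.map (symmRearr n))) := by
  induction l with
  | nil => exact absurd rfl hl
  | cons f l ih =>
    have hf := hd f (by simp)
    cases l with
    | nil =>
      exact .of_setLIntegral_le hf (isDensity_symmRearr hf) (radiallyAntitone_symmRearr f)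
        fun C _ => setLIntegral_le_symmRearr hf.1 C
    | cons g l => exact tailDominates_conv2 hf (ih (by simp) fun k hk => hd k (by simp [hk]))

end Domination

section ConvexFunctions

lemma volume_inter_Ioo_of_upper {S : Set ℝ} (hS0 : S ⊆ Ioi 0) (hS : ∀ s ∈ S, ∀ r, s ≤ r → r ∈ S)
    (x : ℝ) :
    volume (S ∩ Ioo 0 x) = ENNReal.ofReal x - ⨅ s ∈ S, ENNReal.ofReal s := by
  rcases S.eq_empty_or_nonempty with rfl | ⟨s₀, hs₀⟩
  · simp
  set A := ⨅ s ∈ S, ENNReal.ofReal s with hA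
  have hAt : A ≠ ⊤ := ne_top_of_le_ne_top ENNReal.ofReal_ne_top (iInf₂_le s₀ hs₀)
  have hAv : ENNReal.ofReal x - A = ENNReal.ofReal (x - A.toReal) := by
    rw [ENNReal.ofReal_sub _ ENNReal.toReal_nonneg, ENNReal.ofReal_toReal hAt]
  rw [hAv]
  refine le_antisymm ?_ ?_
  · rw [← Real.volume_Icc]
    refine measure_mono fun s hs => ⟨?_, hs.2.2.le⟩
    exact ENNReal.toReal_le_of_le_ofReal (le_of_lt (hS0 hs.1)) (iInf₂_le s hs.1)
  · rw [← Real.volume_Ioo]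
    refine measure_mono fun s hs => ?_
    have hs0 : 0 < s := lt_of_le_of_lt ENNReal.toReal_nonneg hs.1
    have h1 : A < ENNReal.ofReal s := (ENNReal.lt_ofReal_iff_toReal_lt hAt).2 hs.1
    obtain ⟨r, hr, hrs⟩ := by simpa [hA, iInf_lt_iff] using h1
    exact ⟨hS r hr s ((ENNReal.ofReal_lt_ofReal_iff hs0).1 hrs).le, hs0, hs.2⟩

/-- A nonnegative convex function on `[0, ∞)` vanishing at `0` is a mixture of the functions
`x ↦ (x - a)₊`. -/
lemma ConvexOn.exists_eq_lintegral_sub {ψ : ℝ → ℝ} (hψ : ConvexOn ℝ (Ici 0) ψ) (hψ0 : ψ 0 = 0)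
    (hnn : ∀ x, 0 ≤ x → 0 ≤ ψ x) (hc : ContinuousWithinAt ψ (Ici 0) 0) :
    ∃ a : ℝ → ℝ≥0∞, Measurable a ∧ ∀ x, 0 ≤ x →
      ENNReal.ofReal (ψ x) = ∫⁻ u in Ioi (0 : ℝ), (ENNReal.ofReal x - a u) := by
  set p : ℝ → ℝ := fun x => derivWithin ψ (Ioi x) x with hp
  have hint : interior (Ici (0 : ℝ)) = Ioi 0 := interior_Ici
  have hmono : MonotoneOn p (Ioi 0) := by
    have := hψ.monotoneOn_rightDeriv
    rwa [hint] at this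
  have hder : ∀ x, 0 < x → HasDerivWithinAt ψ (p x) (Ioi x) x := fun x hx =>
    hψ.hasDerivWithinAt_rightDeriv_of_mem_interior (by rwa [hint])
  have hψmono : ∀ x y, 0 ≤ x → x ≤ y → ψ x ≤ ψ y := fun x y hx hxy => by
    rcases hx.eq_or_lt with rfl | hx0
    · rw [hψ0]; exact hnn y hxy
    · have hy : 0 < y := hx0.trans_le hxy
      have h := hψ.2 (mem_Ici.2 le_rfl) (mem_Ici.2 hy.le) (sub_nonneg.2
        ((div_le_one hy).2 hxy)) (div_nonneg hx hy.le) (by ring)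
      simp only [smul_eq_mul, mul_zero, zero_add, hψ0, div_mul_cancel₀ x hy.ne'] at h
      exact h.trans (mul_le_of_le_one_left (hnn y hy.le) ((div_le_one hy).2 hxy))
  have hp0 : ∀ x, 0 < x → 0 ≤ p x := fun x hx => by
    refine MonotoneOn.derivWithin_nonneg ?_
    exact fun a (ha : x < a) b _ hab => hψmono a b (hx.trans ha).le hab
  have hcont := hψ.continuousOn_Ici hc
  refine ⟨fun u => ⨅ s ∈ {s | 0 < s ∧ u < p s}, ENNReal.ofReal s, ?_, fun x hx => ?_⟩
  · refine Monotone.measurable fun u v huv => ?_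
    exact iInf_mono fun s => iInf_mono' fun hs => ⟨⟨hs.1, huv.trans_lt hs.2⟩, le_rfl⟩
  · have hcx : ContinuousOn ψ (Icc 0 x) := hcont.mono Icc_subset_Ici_self
    have hi : IntegrableOn p (Ioc 0 x) := intervalIntegral.integrableOn_deriv_right_of_nonneg hcx
      (fun s hs => hder s hs.1) fun s hs => hp0 s hs.1
    have h1 : ∫ s in (0)..x, p s = ψ x := by
      rw [intervalIntegral.integral_eq_sub_of_hasDeriv_right_of_le hx hcx
        (fun s hs => hder s hs.1) ((intervalIntegrable_iff_integrableOn_Ioc_of_le hx).2 hi),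
        hψ0, sub_zero]
    rw [intervalIntegral.integral_of_le hx, integral_Ioc_eq_integral_Ioo] at h1
    have hnn' : 0 ≤ᵐ[volume.restrict (Ioo 0 x)] p :=
      (ae_restrict_iff' measurableSet_Ioo).2 (ae_of_all _ fun s hs => hp0 s hs.1)
    have hi' := hi.mono_set Ioo_subset_Ioc_self
    rw [← h1, ofReal_integral_eq_lintegral_ofReal hi' hnn',
      lintegral_eq_lintegral_meas_lt _ hnn' hi'.aemeasurable]
    refine setLIntegral_congr_fun measurableSet_Ioi fun u hu => ?_
    simp only
    rw [← volume_inter_Ioo_of_upper (S := {s | 0 < s ∧ u < p s}) (fun s hs => hs.1)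
      (fun s hs r hsr => ⟨hs.1.trans_le hsr, hs.2.trans_le (hmono hs.1 (hs.1.trans_le hsr) hsr)⟩),
      Measure.restrict_apply' measurableSet_Ioo]
    congr 1
    ext s
    simp only [mem_inter_iff, mem_ofPred_eq, mem_Ioo]
    tauto

variable {α : Type*} [MeasurableSpace α] {μ : Measure α}

lemma ConvexOn.lintegral_ofReal_le_of_tail_le [SFinite μ] {ψ : ℝ → ℝ}
    (hψ : ConvexOn ℝ (Ici 0) ψ) (hψ0 : ψ 0 = 0)
    (hnn : ∀ x, 0 ≤ x → 0 ≤ ψ x) (hc : ContinuousWithinAt ψ (Ici 0) 0) {F G : α → ℝ≥0∞}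
    (hF : Measurable F) (hG : Measurable G) (hFt : ∀ᵐ x ∂μ, F x < ⊤) (hGt : ∀ᵐ x ∂μ, G x < ⊤)
    (h : ∀ t : ℝ≥0∞, ∫⁻ x, (F x - t) ∂μ ≤ ∫⁻ x, (G x - t) ∂μ) :
    ∫⁻ x, ENNReal.ofReal (ψ (F x).toReal) ∂μ ≤ ∫⁻ x, ENNReal.ofReal (ψ (G x).toReal) ∂μ := by
  obtain ⟨a, ha, hψa⟩ := hψ.exists_eq_lintegral_sub hψ0 hnn hc
  have hl : ∀ {k : α → ℝ≥0∞}, Measurable k → (∀ᵐ x ∂μ, k x < ⊤) →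
      ∫⁻ x, ENNReal.ofReal (ψ (k x).toReal) ∂μ =
        ∫⁻ u in Ioi (0 : ℝ), ∫⁻ x, (k x - a u) ∂μ := fun {k} hk hkt => by
    rw [lintegral_lintegral_swap]
    · refine lintegral_congr_ae (hkt.mono fun x hx => ?_)
      simp only
      rw [hψa _ ENNReal.toReal_nonneg, ENNReal.ofReal_toReal hx.ne]
    · exact ((hk.comp measurable_snd).sub (ha.comp measurable_fst)).aemeasurable
  rw [hl hF hFt, hl hG hGt]
  exact lintegral_mono fun u => h (a u)

lemma ofReal_add_ofReal_eq {a b : ℝ} (hb : 0 ≤ b) : ENNReal.ofReal a + ENNReal.ofReal b =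
    ENNReal.ofReal (max (a + b) 0) + min (ENNReal.ofReal (-a)) (ENNReal.ofReal b) := by
  have hmin : min (ENNReal.ofReal (-a)) (ENNReal.ofReal b) =
      ENNReal.ofReal (min (max (-a) 0) b) := by
    rw [ENNReal.ofReal_min, ENNReal.ofReal_max]
    simp
  have hmax : ENNReal.ofReal a = ENNReal.ofReal (max a 0) := by simp
  rw [hmin, hmax, ← ENNReal.ofReal_add (by positivity) hb,
    ← ENNReal.ofReal_add (by positivity) (by positivity)]
  congr 1
  rcases le_total a 0 with h | h
  · rw [max_eq_right h, max_eq_left (neg_nonneg.2 h)]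
    rcases le_total (a + b) 0 with h' | h'
    · rw [max_eq_right h', min_eq_right (by linarith)]
    · rw [max_eq_left h', min_eq_left (by linarith)]; ring
  · rw [max_eq_left h, max_eq_right (neg_nonpos.2 h), max_eq_left (by linarith), min_eq_left hb,
      add_zero]

/-- Tail domination gives comparison of `∫ φ` in a form free of subtraction. -/
lemma ConvexOn.lintegral_pos_add_neg_le_of_tail_le [SFinite μ] {φ : ℝ → ℝ}
    (hφ : ConvexOn ℝ (Ici 0) φ) (hφ0 : φ 0 = 0) (hφc : ContinuousWithinAt φ (Ici 0) 0)
    {F G : α → ℝ≥0∞} (hF : Measurable F) (hG : Measurable G)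
    (hF1 : ∫⁻ x, F x ∂μ = 1) (hG1 : ∫⁻ x, G x ∂μ = 1)
    (h : ∀ t : ℝ≥0∞, ∫⁻ x, (F x - t) ∂μ ≤ ∫⁻ x, (G x - t) ∂μ) :
    ∫⁻ x, ENNReal.ofReal (φ (F x).toReal) ∂μ + ∫⁻ x, ENNReal.ofReal (-φ (G x).toReal) ∂μ ≤
      ∫⁻ x, ENNReal.ofReal (φ (G x).toReal) ∂μ +
        ∫⁻ x, ENNReal.ofReal (-φ (F x).toReal) ∂μ := by
  have hFt := ae_lt_top hF (hF1.trans_ne one_ne_top)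
  have hGt := ae_lt_top hG (hG1.trans_ne one_ne_top)
  have hcont := hφ.continuousOn_Ici hφc
  have hm : ∀ {k : α → ℝ≥0∞}, Measurable k → Measurable fun x => φ (k x).toReal :=
    fun {k} hk => by
      have h1 : Continuous fun x : ℝ => φ (max x 0) :=
        hcont.comp_continuous (continuous_id.max continuous_const) fun x =>
          mem_Ici.2 (le_max_right _ _)
      have h2 := h1.measurable.comp hk.ennreal_toReal
      simpa [Function.comp_def] using h2
  set N : ℕ → (α → ℝ≥0∞) → α → ℝ≥0∞ := fun j k x =>
    min (ENNReal.ofReal (-φ (k x).toReal)) (j * k x) with hN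
  have hNm : ∀ j {k : α → ℝ≥0∞}, Measurable k → Measurable (N j k) := fun j k hk =>
    (hm hk).neg.ennreal_ofReal.min (measurable_const.mul hk)
  have hNle : ∀ j {k : α → ℝ≥0∞}, Measurable k → ∫⁻ x, k x ∂μ = 1 →
      ∫⁻ x, N j k x ∂μ ≤ j := fun j k hk hk1 => by
    calc ∫⁻ x, N j k x ∂μ ≤ ∫⁻ x, j * k x ∂μ := lintegral_mono fun x => min_le_right _ _
      _ = j := by rw [lintegral_const_mul _ hk, hk1, mul_one]
  have hid : ∀ (j : ℕ) {k : α → ℝ≥0∞}, Measurable k → (∀ᵐ x ∂μ, k x < ⊤) →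
      ∫⁻ x, k x ∂μ = 1 → ∫⁻ x, ENNReal.ofReal (φ (k x).toReal) ∂μ + j =
        ∫⁻ x, ENNReal.ofReal (max (φ (k x).toReal + j * (k x).toReal) 0) ∂μ +
          ∫⁻ x, N j k x ∂μ := fun j {k} hk hkt hk1 => by
    have hj : (j : ℝ≥0∞) = ∫⁻ x, j * k x ∂μ := by rw [lintegral_const_mul _ hk, hk1, mul_one]
    conv_lhs => rw [hj]
    rw [← lintegral_add_left (hm hk).ennreal_ofReal, ← lintegral_add_right _ (hNm j hk)]
    refine lintegral_congr_ae (hkt.mono fun x hx => ?_)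
    have hjx : (j : ℝ≥0∞) * k x = ENNReal.ofReal (j * (k x).toReal) := by
      rw [ENNReal.ofReal_mul (Nat.cast_nonneg j), ENNReal.ofReal_natCast,
        ENNReal.ofReal_toReal hx.ne]
    simp only [hN]
    rw [hjx]
    exact ofReal_add_ofReal_eq (by positivity)
  have hj : ∀ j : ℕ, ∫⁻ x, ENNReal.ofReal (φ (F x).toReal) ∂μ + ∫⁻ x, N j G x ∂μ ≤
      ∫⁻ x, ENNReal.ofReal (φ (G x).toReal) ∂μ + ∫⁻ x, N j F x ∂μ := fun j => by
    have hψ : ConvexOn ℝ (Ici 0) fun x => max (φ x + j * x) 0 :=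
      (hφ.add (((convexOn_id (convex_Ici 0)).smul (Nat.cast_nonneg j)))).sup
        (convexOn_const 0 (convex_Ici 0))
    have hle := hψ.lintegral_ofReal_le_of_tail_le (by simp [hφ0]) (fun x _ => le_max_right _ _)
      ((hφc.add (continuousWithinAt_const.mul continuousWithinAt_id)).max
        continuousWithinAt_const) hF hG hFt hGt h
    refine (ENNReal.add_le_add_iff_right (ENNReal.natCast_ne_top j)).1 ?_
    rw [add_right_comm, hid j hF hFt hF1, add_right_comm _ _ (j : ℝ≥0∞), hid j hG hGt hG1,
      add_right_comm]
    gcongr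
  have hsup : ∫⁻ x, ENNReal.ofReal (-φ (G x).toReal) ∂μ = ⨆ j, ∫⁻ x, N j G x ∂μ := by
    rw [← lintegral_iSup (fun j => hNm j hG) fun i j hij x => by
      simp only [hN]
      gcongr]
    refine lintegral_congr fun x => ?_
    by_cases hx : G x = 0
    · simp [hN, hx, hφ0]
    · have : ⨆ j : ℕ, (j : ℝ≥0∞) * G x = ⊤ := by
        rw [← ENNReal.iSup_mul, ENNReal.iSup_natCast, ENNReal.top_mul hx]
      simp only [hN]
      rw [← inf_iSup_eq, this, inf_top_eq]
  rw [hsup, ENNReal.add_iSup]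
  exact iSup_le fun j => (hj j).trans
    (add_le_add le_rfl (lintegral_mono fun x => min_le_left _ _))

lemma EReal.coe_sub_coe_le_of_add_le_add {a b c d : ℝ≥0∞} (hab : a ≠ ⊤ ∨ b ≠ ⊤)
    (hcd : c ≠ ⊤ ∨ d ≠ ⊤) (h : a + d ≤ c + b) : (a : EReal) - b ≤ (c : EReal) - d := by
  by_cases hc : c = ⊤
  · have hd := hcd.resolve_left (not_not.2 hc)
    lift d to NNReal using hd
    subst hc
    have : ((⊤ : ℝ≥0∞) : EReal) - ((d : ℝ≥0∞) : EReal) = ⊤ := rfl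
    rw [this]
    exact le_top
  by_cases hb : b = ⊤
  · have ha := hab.resolve_right (not_not.2 hb)
    lift a to NNReal using ha
    subst hb
    have : ((a : ℝ≥0∞) : EReal) - ((⊤ : ℝ≥0∞) : EReal) = ⊥ := rfl
    rw [this]
    exact bot_le
  have hcb : c + b ≠ ⊤ := ENNReal.add_ne_top.2 ⟨hc, hb⟩
  have had := ENNReal.add_ne_top.1 (ne_top_of_le_ne_top hcb h)
  obtain ⟨ha, hd⟩ := had
  lift a to NNReal using ha
  lift b to NNReal using hb
  lift c to NNReal using hc
  lift d to NNReal using hd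
  have h' : (a : ℝ) + d ≤ c + b := by exact_mod_cast h
  have : (((a : ℝ) - b : ℝ) : EReal) ≤ ((c - d : ℝ) : EReal) :=
    EReal.coe_le_coe_iff.2 (by linarith)
  exact this

end ConvexFunctions

/-- General convex test functions under convolution: for probability densities
`f₁,…,f_k` on `ℝⁿ` and convex `φ : [0,∞) → ℝ` with `φ(0) = 0` continuous at `0`,
`∫ φ(f₁ ⋆ ⋯ ⋆ f_k) ≤ ∫ φ(f₁* ⋆ ⋯ ⋆ f_k*)`, provided both sides are well defined. -/
theorem phiInt_convList_symmRearr (n : ℕ) (φ : ℝ → ℝ) (hφ : ConvexOn ℝ (Ici 0) φ)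
    (hφ0 : φ 0 = 0) (hφc : ContinuousWithinAt φ (Ici 0) 0)
    (l : List (EuclideanSpace ℝ (Fin n) → ℝ≥0∞)) (hl : l ≠ [])
    (hd : ∀ f ∈ l, IsDensity n f)
    (h1 : PhiDefined n φ (convList n l))
    (h2 : PhiDefined n φ (convList n (l.map (symmRearr n)))) :
    phiInt n φ (convList n l) ≤ phiInt n φ (convList n (l.map (symmRearr n))) := by
  have h := tailDominates_convList hl hd
  exact EReal.coe_sub_coe_le_of_add_le_add h1 h2
    (hφ.lintegral_pos_add_neg_le_of_tail_le hφ0 hφc h.isDensity_left.1 h.isDensity_right.1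
      h.isDensity_left.2 h.isDensity_right.2 h.tail_le)
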